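/- Assume 𝓘 is not contained in the radical of Ann(M). Let k_0, j, k_1,…,k_q be non-negative integers with k_0 + j + k_1 + ⋯ + k_q = D = dim Supp(M*) and let i ≥ 1 be an index with k_i > 0. If x ∈ I_i is an (FC)-element with respect to (J, I_1,…,I_q; M), then e^j(J^{[k_0]}, I_1^{[k_1]},…,I_i^{[k_i]},…,I_q^{[k_q]}; M) = e^j(J^{[k_0]}, I_1^{[k_1]},…,I_i^{[k_i−1]},…,I_q^{[k_q]}; M/xM). -/

import Mathlib

/- Common framework: graded algebras over a Noetherian local ring, products of
linear submodules with graded pieces of a module, (FC)-sequences, saturations,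
Hilbert polynomials of several variables, mixed multiplicities and
Buchsbaum-Rim multiplicities. -/

open scoped BigOperators

noncomputable section

namespace MixedMult

variable {R A M : Type*} [CommRing R] [CommRing A] [Algebra R A]
  [AddCommGroup M] [Module R M] [Module A M] [IsScalarTower R A M]

/-- The product `I·N` of an `R`-submodule `I` of the algebra `A` with an
`R`-submodule `N` of the `A`-module `M`. -/
def smulSM (I : Submodule R A) (N : Submodule R M) : Submodule R M :=
  Submodule.span R {z : M | ∃ a ∈ I, ∃ m ∈ N, a • m = z}

/-- The multi-index power `I₁^{r₁} ⋯ I_s^{r_s}` of a family of `R`-submodules of `A`. -/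
def Ipow {s : ℕ} (F : Fin s → Submodule R A) (r : Fin s → ℕ) : Submodule R A :=
  ∏ i, F i ^ r i

/-- The ideal `𝓘` of `A` generated by the product `I₁⋯I_q`. -/
def idealGen {s : ℕ} (I : Fin s → Submodule R A) : Ideal A :=
  Ideal.span ((∏ i, I i : Submodule R A) : Set A)

/-- The saturation `(U :_M 𝓘^∞) = {z ∈ M | 𝓘^k z ⊆ U for some k}`. -/
def sat (𝓘 : Ideal A) (U : Submodule A M) : Submodule A M :=
  ⨆ k : ℕ, ⨅ a ∈ 𝓘 ^ k, U.comap (LinearMap.lsmul A M a)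

/-- The `A`-submodule `(x₁,…,x_t)M` of `M` generated by a set of elements of `A`. -/
def spanM (s : Set A) : Submodule A M := Ideal.span s • (⊤ : Submodule A M)

/-- The length `ℓ(Q/P)` of the subquotient `Q/(P ∩ Q)` of two `R`-submodules of a module. -/
def colength (R : Type*) {M : Type*} [CommRing R] [AddCommGroup M] [Module R M]
    (P Q : Submodule R M) : ℕ∞ :=
  Order.height (⊤ : Submodule R (↥Q ⧸ P.comap Q.subtype))

/-- `dim Supp (M/N)`: the Krull dimension of the support of `M/N` inside `Proj A`, i.e. the
set of homogeneous primes of `A` not containing `A₊` but containing the annihilator. -/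
def dimProjSupp (𝒜 : ℕ → Submodule R A) [GradedAlgebra 𝒜] (N : Submodule A M) :
    WithBot ℕ∞ :=
  Order.krullDim {P : PrimeSpectrum A //
    Ideal.IsHomogeneous 𝒜 P.asIdeal ∧ ¬ ((𝒜 1 : Set A) ⊆ ↑P.asIdeal) ∧
    Module.annihilator A (M ⧸ N) ≤ P.asIdeal}

/-- The dimension of `Proj` of the graded ring `A`. -/
def dimProj (𝒜 : ℕ → Submodule R A) [GradedAlgebra 𝒜] : WithBot ℕ∞ :=
  Order.krullDim {P : PrimeSpectrum A //
    Ideal.IsHomogeneous 𝒜 P.asIdeal ∧ ¬ ((𝒜 1 : Set A) ⊆ ↑P.asIdeal)}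

/-- `b = a - 1`, where dimensions take values in `WithBot ℕ∞` and the empty
support has dimension `⊥` (i.e. `-∞`, playing the role of `-1`). -/
def DropsByOne (a b : WithBot ℕ∞) : Prop :=
  b = a + 1 ∨ (b = 0 ∧ a = ⊥)

/-- The height of an ideal: the infimum of the heights of the primes containing it. -/
def idealHeight {B : Type*} [CommRing B] (I : Ideal B) : ℕ∞ :=
  ⨅ P : {P : PrimeSpectrum B // I ≤ P.asIdeal}, Order.height (P : PrimeSpectrum B)

variable (R) in
/-- `x` is a weak-(FC)-element at index `i` with respect to the family `F` of
`R`-submodules of `A₁` and the graded module `ℳ`, relative to a previous stage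
given by the degree-one part `S` (span of the previously chosen elements) and
`K ⊆ M` (the submodule generated by the previously chosen elements), so that the
conditions are those of the images in `A/(x₁,…)` and `M/(x₁,…)M`.
`(FC₁)`: `x ∈ F i ∖ 𝔪·F i` and `F^r M_p ∩ x M_{|r|+p-1} = x F^{r-δ(i)} M_p` for all `p`
and all `r` with `r i` large; `(FC₂)`: `(0 : x) ⊆ (0 : 𝓘^∞)`. -/
def IsWeakFCElemAt [IsLocalRing R] {s : ℕ} (ℳ : ℕ → Submodule R M)
    (F : Fin s → Submodule R A) (𝓘 : Ideal A) (i : Fin s) (x : A)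
    (S : Submodule R A) (K : Submodule A M) : Prop :=
  x ∈ F i ∧ x ∉ ((IsLocalRing.maximalIdeal R) • F i ⊔ S) ∧
  (∃ ri : ℕ, 0 < ri ∧ ∀ (p : ℕ) (r : Fin s → ℕ), ri ≤ r i →
    (smulSM (Ipow F r) (ℳ p) ⊔ K.restrictScalars R) ⊓
      (smulSM (Submodule.span R {x}) (ℳ ((∑ l, r l) + p - 1)) ⊔ K.restrictScalars R) =
      smulSM (Submodule.span R {x} * Ipow F (Function.update r i (r i - 1))) (ℳ p) ⊔
        K.restrictScalars R) ∧
  K.comap (LinearMap.lsmul A M x) ≤ sat 𝓘 K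

variable (R) in
/-- `x` is an (FC)-element at index `i`: a weak-(FC)-element which moreover satisfies
`(FC₃)`: `dim Supp (M/(xM : 𝓘^∞)) = dim Supp (M/(0 : 𝓘^∞)) - 1` (relative to the
previous stage `(S, K)`). -/
def IsFCElemAt [IsLocalRing R] (𝒜 : ℕ → Submodule R A) [GradedAlgebra 𝒜] {s : ℕ}
    (ℳ : ℕ → Submodule R M) (F : Fin s → Submodule R A) (𝓘 : Ideal A) (i : Fin s)
    (x : A) (S : Submodule R A) (K : Submodule A M) : Prop :=
  IsWeakFCElemAt R ℳ F 𝓘 i x S K ∧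
    DropsByOne (dimProjSupp 𝒜 (sat 𝓘 (K ⊔ spanM {x}))) (dimProjSupp 𝒜 (sat 𝓘 K))

/-- The set of predecessors of `x j` in the sequence `x`. -/
def prevSet {t : ℕ} (x : Fin t → A) (j : Fin t) : Set A := x '' {l | l < j}

variable (R) in
/-- `x₁,…,x_t` is a weak-(FC)-sequence with respect to `(F; ℳ)`, where `x_j` is taken in
`F (c j)`: each `x_j` is a weak-(FC)-element modulo the previously chosen elements. -/
def IsWeakFCSeq [IsLocalRing R] {s t : ℕ} (ℳ : ℕ → Submodule R M)
    (F : Fin s → Submodule R A) (𝓘 : Ideal A) (x : Fin t → A) (c : Fin t → Fin s) : Prop :=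
  ∀ j, IsWeakFCElemAt R ℳ F 𝓘 (c j) (x j)
    (Submodule.span R (prevSet x j)) (spanM (prevSet x j))

variable (R) in
/-- `x₁,…,x_t` is an (FC)-sequence with respect to `(F; ℳ)`. -/
def IsFCSeq [IsLocalRing R] (𝒜 : ℕ → Submodule R A) [GradedAlgebra 𝒜] {s t : ℕ}
    (ℳ : ℕ → Submodule R M) (F : Fin s → Submodule R A) (𝓘 : Ideal A)
    (x : Fin t → A) (c : Fin t → Fin s) : Prop :=
  ∀ j, IsFCElemAt R 𝒜 ℳ F 𝓘 (c j) (x j)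
    (Submodule.span R (prevSet x j)) (spanM (prevSet x j))

/-- `x` is an `ε`-superficial element for the family `F` with respect to `ℳ`, relative to a
previous stage `K`: `x ∈ F ε` and the image of `x` is a filter-regular element on
`T = ⊕ F^r M_{p+s}/F^{r+1} M_p`, i.e. for all `r ≫ 0` and all `p`, any `z ∈ F^r M_{p+s}`
with `x·z ∈ F^{r+1+δ(ε)} M_p` lies in `F^{r+1} M_p`. -/
def IsSuperficialAt {s : ℕ} (ℳ : ℕ → Submodule R M) (F : Fin s → Submodule R A)
    (ε : Fin s) (x : A) (K : Submodule A M) : Prop :=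
  x ∈ F ε ∧ ∃ r₀ : ℕ, ∀ (r : Fin s → ℕ) (p : ℕ), (∀ i, r₀ ≤ r i) →
    (smulSM (Ipow F r) (ℳ (p + s)) ⊔ K.restrictScalars R) ⊓
      ((smulSM (Ipow F (fun l => r l + 1 + (if l = ε then 1 else 0))) (ℳ p) ⊔
          K.restrictScalars R).comap ((LinearMap.lsmul A M x).restrictScalars R)) ≤
      smulSM (Ipow F (fun l => r l + 1)) (ℳ p) ⊔ K.restrictScalars R

/-- `x₁,…,x_m` is an `(ε₁,…,ε_m)`-superficial sequence for the family `F` with respect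
to `ℳ`: each `x_j` is `ε_j`-superficial modulo the previously chosen elements. -/
def IsSuperficialSeq {s m : ℕ} (ℳ : ℕ → Submodule R M) (F : Fin s → Submodule R A)
    (x : Fin m → A) (ε : Fin m → Fin s) : Prop :=
  ∀ j, IsSuperficialAt ℳ F (ε j) (x j) (spanM (prevSet x j))

/-- The evaluation point `(n, p, r₁, …, r_q)` as rationals. -/
def vals {q : ℕ} (n p : ℕ) (r : Fin q → ℕ) : Fin (q + 2) → ℚ :=
  Fin.cons (n : ℚ) (Fin.cons (p : ℚ) fun i => (r i : ℚ))

/-- The Hilbert function `ℓ(I^r M_{n+p} / J^n I^r M_p)`. -/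
def mixedLen {q : ℕ} (J : Submodule R A) (I : Fin q → Submodule R A)
    (ℳ : ℕ → Submodule R M) (n p : ℕ) (r : Fin q → ℕ) : ℕ∞ :=
  colength R (smulSM (J ^ n * Ipow I r) (ℳ p)) (smulSM (Ipow I r) (ℳ (n + p)))

/-- `P` is a polynomial (in the `q+2` variables `n, p, r₁, …, r_q`) which agrees with
the Hilbert function `ℓ(I^r M_{n+p}/J^n I^r M_p)` for all sufficiently large `n, p, r`. -/
def IsMixedPoly {q : ℕ} (J : Submodule R A) (I : Fin q → Submodule R A)
    (ℳ : ℕ → Submodule R M) (P : MvPolynomial (Fin (q + 2)) ℚ) : Prop :=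
  ∃ N₀ : ℕ, ∀ (n p : ℕ) (r : Fin q → ℕ), N₀ ≤ n → N₀ ≤ p → (∀ i, N₀ ≤ r i) →
    ∃ L : ℕ, mixedLen J I ℳ n p r = (L : ℕ∞) ∧
      MvPolynomial.eval (vals n p r) P = (L : ℚ)

/-- The mixed multiplicity `e^j(J^{[k₀]}, I₁^{[k₁]}, …, I_q^{[k_q]})` read off from a
Hilbert polynomial `P`: `k₀!·j!·k! ·` (coefficient of `n^{k₀} p^j r^k` in `P`). -/
def mixedCoeff {q : ℕ} (P : MvPolynomial (Fin (q + 2)) ℚ) (k0 j : ℕ) (k : Fin q → ℕ) : ℚ :=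
  (k0.factorial * j.factorial * ∏ i, (k i).factorial : ℚ) *
    MvPolynomial.coeff (Finsupp.equivFunOnFinite.symm (Fin.cons k0 (Fin.cons j k))) P

/-- The Hilbert function `ℓ(M_{n+u} / U^n M_u)` of the pair `(U, A)` with respect to `ℳ`. -/
def brLen (U : Submodule R A) (ℳ : ℕ → Submodule R M) (n u : ℕ) : ℕ∞ :=
  colength R (smulSM (U ^ n) (ℳ u)) (ℳ (n + u))

/-- `P` is a polynomial in two variables `(n, u)` agreeing with `ℓ(M_{n+u}/U^n M_u)`
for all large `n, u`. -/
def IsBRPoly (U : Submodule R A) (ℳ : ℕ → Submodule R M)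
    (P : MvPolynomial (Fin 2) ℚ) : Prop :=
  ∃ N₀ : ℕ, ∀ n u : ℕ, N₀ ≤ n → N₀ ≤ u →
    ∃ L : ℕ, brLen U ℳ n u = (L : ℕ∞) ∧
      MvPolynomial.eval ![(n : ℚ), (u : ℚ)] P = (L : ℚ)

/-- The `j`-th associated Buchsbaum-Rim multiplicity read off from a Hilbert polynomial
`P` of total degree `d`: `(d-j)!·j! ·` (coefficient of `n^{d-j} u^j` in `P`). -/
def brCoeff (P : MvPolynomial (Fin 2) ℚ) (d j : ℕ) : ℚ :=
  ((d - j).factorial * j.factorial : ℚ) *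
    MvPolynomial.coeff (Finsupp.equivFunOnFinite.symm ![d - j, j]) P

/-- The graded pieces of the quotient module `M/N`. -/
def quotPieces (ℳ : ℕ → Submodule R M) (N : Submodule A M) : ℕ → Submodule R (M ⧸ N) :=
  fun n => (ℳ n).map (N.mkQ.restrictScalars R)


section GrowthBound

open Filter

/-- `h t = O(t ^ (d - 1))`, with the convention that `d = 0` means eventually zero. -/
def GrowthBounded : ℕ → (ℕ → ℕ∞) → Prop
  | 0, h => ∀ᶠ t in atTop, h t = 0
  | d + 1, h => ∃ K : ℕ, ∀ᶠ t in atTop, h t ≤ ((K * t ^ d : ℕ) : ℕ∞)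

theorem GrowthBounded.mono {d : ℕ} {g h : ℕ → ℕ∞} (hg : GrowthBounded d g)
    (hle : ∀ᶠ t in atTop, h t ≤ g t) :
    GrowthBounded d h := by
  cases d with
  | zero =>
    filter_upwards [hg, hle] with t h1 h2
    rw [h1] at h2
    exact le_antisymm h2 bot_le
  | succ d =>
    obtain ⟨K, hK⟩ := hg
    refine ⟨K, ?_⟩
    filter_upwards [hK, hle] with t h1 h2 using h2.trans h1

theorem GrowthBounded.of_eventually_zero {d : ℕ} {h : ℕ → ℕ∞} (hz : ∀ᶠ t in atTop, h t = 0) :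
    GrowthBounded d h := by
  cases d with
  | zero => exact hz
  | succ d =>
    refine ⟨0, ?_⟩
    filter_upwards [hz] with t ht
    simp [ht]

theorem GrowthBounded.add {d : ℕ} {g h : ℕ → ℕ∞} (hg : GrowthBounded d g) (hh : GrowthBounded d h) :
    GrowthBounded d (fun t => g t + h t) := by
  cases d with
  | zero =>
    filter_upwards [hg, hh] with t h1 h2
    simp [h1, h2]
  | succ d =>
    obtain ⟨K, hK⟩ := hg
    obtain ⟨L, hL⟩ := hh
    refine ⟨K + L, ?_⟩
    filter_upwards [hK, hL] with t h1 h2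
    refine (add_le_add h1 h2).trans ?_
    rw [add_mul]
    push_cast
    exact le_rfl

theorem GrowthBounded.shift {d u : ℕ} {h : ℕ → ℕ∞} (hh : GrowthBounded d h) :
    GrowthBounded d (fun t => h (t - u)) := by
  have ht : Tendsto (fun t : ℕ => t - u) atTop atTop := tendsto_sub_atTop_nat u
  cases d with
  | zero => exact ht.eventually hh
  | succ d =>
    obtain ⟨K, hK⟩ := hh
    refine ⟨K, ?_⟩
    filter_upwards [ht.eventually hK] with t h1
    refine h1.trans ?_
    exact_mod_cast Nat.mul_le_mul_left K (Nat.pow_le_pow_left (Nat.sub_le t u) d)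

theorem GrowthBounded.of_step {d : ℕ} {g h : ℕ → ℕ∞} (hg : GrowthBounded d g)
    (hfin : ∀ᶠ t in atTop, h t ≠ ⊤)
    (hstep : ∀ᶠ t in atTop, h (t + 1) ≤ h t + g (t + 1)) : GrowthBounded (d + 1) h := by
  cases d with
  | zero =>
    obtain ⟨T, hT⟩ := eventually_atTop.1 ((hfin.and hstep).and hg)
    obtain ⟨C, hC⟩ := ENat.ne_top_iff_exists.1 (hT T le_rfl).1.1
    refine ⟨C, eventually_atTop.2 ⟨T, fun t ht => ?_⟩⟩
    induction t, ht using Nat.le_induction with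
    | base => simp [← hC]
    | succ t ht ih =>
      refine (hT t ht).1.2.trans ?_
      rw [(hT (t + 1) (by omega)).2]
      simpa using ih
  | succ d =>
    obtain ⟨K, hK⟩ := hg
    obtain ⟨T, hT⟩ := eventually_atTop.1 ((hfin.and hstep).and hK)
    obtain ⟨C, hC⟩ := ENat.ne_top_iff_exists.1 (hT T le_rfl).1.1
    refine ⟨C + K, eventually_atTop.2 ⟨T + 1, fun t ht => ?_⟩⟩
    have key : ∀ t, T ≤ t → h t ≤ ((C + K * t ^ (d + 1) : ℕ) : ℕ∞) := by
      intro t ht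
      induction t, ht using Nat.le_induction with
      | base => rw [← hC]; exact_mod_cast Nat.le_add_right _ _
      | succ t ht ih =>
        refine ((hT t ht).1.2.trans (add_le_add ih (hT (t + 1) (by omega)).2)).trans ?_
        have h1 : t ^ (d + 1) + (t + 1) ^ d ≤ (t + 1) ^ (d + 1) := by
          rw [pow_succ, pow_succ, mul_add, mul_one]
          gcongr
          omega
        have h2 : C + K * t ^ (d + 1) + K * (t + 1) ^ d ≤ C + K * (t + 1) ^ (d + 1) := by
          rw [add_assoc, ← mul_add]
          gcongr
        exact_mod_cast h2
    refine (key t (by omega)).trans ?_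
    have : 1 ≤ t ^ (d + 1) := Nat.one_le_pow _ _ (by omega)
    have h2 : C + K * t ^ (d + 1) ≤ (C + K) * t ^ (d + 1) := by
      rw [add_mul]
      gcongr
      exact Nat.le_mul_of_pos_right C this
    exact_mod_cast h2

section Growth

variable {R A : Type*} [CommRing R] [CommRing A] [Algebra R A]

/-- A subadditive length-type function `lam P Q` of the subquotients `Q / (P ⊓ Q)` of `A`. -/
structure IsSubLength (lam : Submodule R A → Submodule R A → ℕ∞) : Prop where
  zero : ∀ P Q : Submodule R A, Q ≤ P → lam P Q = 0
  anti : ∀ P P' Q : Submodule R A, P ≤ P' → lam P' Q ≤ lam P Q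
  sub : ∀ (a : A) (P Q P' T : Submodule R A), T.map (LinearMap.mulLeft R a) ≤ Q →
    P'.map (LinearMap.mulLeft R a) ≤ P →
    lam P Q ≤ lam (P ⊔ T.map (LinearMap.mulLeft R a)) Q + lam P' T

/-- The function `t ↦ lam (𝔞_t + E ^ (t - w) A_w) A_t`. -/
def growth (𝒜 : ℕ → Submodule R A) (lam : Submodule R A → Submodule R A → ℕ∞)
    (E : Submodule R A) (𝔞 : Ideal A) (w t : ℕ) : ℕ∞ :=
  lam ((𝔞.restrictScalars R ⊓ 𝒜 t) ⊔ E ^ (t - w) * 𝒜 w) (𝒜 t)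

variable (𝒜 : ℕ → Submodule R A) [GradedAlgebra 𝒜]

theorem sup_span_inf_le {𝔞 : Ideal A} (h𝔞 : 𝔞.IsHomogeneous 𝒜) {u t : ℕ} (hut : u ≤ t) {a : A}
    (ha : a ∈ 𝒜 u) : (𝔞 ⊔ Ideal.span {a}).restrictScalars R ⊓ 𝒜 t ≤
      (𝔞.restrictScalars R ⊓ 𝒜 t) ⊔ (𝒜 (t - u)).map (LinearMap.mulLeft R a) := by
  rintro z ⟨hz, hzt⟩
  obtain ⟨y, hy, w, hw, rfl⟩ := Submodule.mem_sup.1 hz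
  obtain ⟨b, rfl⟩ := Ideal.mem_span_singleton'.1 hw
  have h1 : y + b * a =
      (DirectSum.decompose 𝒜 y t : A) + (DirectSum.decompose 𝒜 (b * a) t : A) := by
    conv_lhs => rw [← DirectSum.decompose_of_mem_same 𝒜 hzt]
    rw [DirectSum.decompose_add]
    simp
  rw [h1, mul_comm b a, DirectSum.coe_decompose_mul_of_left_mem_of_le 𝒜 ha hut]
  refine Submodule.add_mem_sup ⟨(h𝔞 t hy), SetLike.coe_mem _⟩ ?_
  exact ⟨_, SetLike.coe_mem _, rfl⟩

theorem isHomogeneous_colon {𝔞 : Ideal A} (h𝔞 : 𝔞.IsHomogeneous 𝒜) {u : ℕ} {a : A}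
    (ha : a ∈ 𝒜 u) : (Submodule.comap (LinearMap.mulLeft A a) 𝔞).IsHomogeneous 𝒜 := by
  intro n b hb
  have hb' : a * b ∈ 𝔞 := hb
  have := h𝔞 (u + n) hb'
  rw [DirectSum.coe_decompose_mul_add_of_left_mem 𝒜 ha] at this
  exact this

theorem growth_le_of_mem {lam : Submodule R A → Submodule R A → ℕ∞} (hlam : IsSubLength lam)
    {E : Submodule R A} {𝔞 : Ideal A} (h𝔞 : 𝔞.IsHomogeneous 𝒜) {u w t : ℕ} (huw : u ≤ w) (hwt : w ≤ t)
    {a : A} (ha : a ∈ 𝒜 u) :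
    growth 𝒜 lam E 𝔞 w t ≤ growth 𝒜 lam E (𝔞 ⊔ Ideal.span {a}) w t +
      growth 𝒜 lam E (Submodule.comap (LinearMap.mulLeft A a) 𝔞) (w - u) (t - u) := by
  have hmul : ∀ {m n : ℕ} {b : A}, b ∈ 𝒜 n → m = u + n → a * b ∈ 𝒜 m := by
    rintro m n b hb rfl
    exact SetLike.mul_mem_graded ha hb
  have hT : (𝒜 (t - u)).map (LinearMap.mulLeft R a) ≤ 𝒜 t := by
    rintro _ ⟨b, hb, rfl⟩
    exact hmul hb (by omega)
  refine (hlam.sub a _ _ (((Submodule.comap (LinearMap.mulLeft A a) 𝔞).restrictScalars R ⊓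
    𝒜 (t - u)) ⊔ E ^ (t - u - (w - u)) * 𝒜 (w - u)) (𝒜 (t - u)) hT ?_).trans ?_
  · rw [Submodule.map_sup]
    refine sup_le_sup ?_ ?_
    · rintro _ ⟨b, ⟨hb1, hb2⟩, rfl⟩
      exact ⟨hb1, hmul hb2 (by omega)⟩
    · rintro _ ⟨b, hb, rfl⟩
      rw [show t - u - (w - u) = t - w by omega] at hb
      have h2 : a * b ∈ Submodule.span R {a} * (E ^ (t - w) * 𝒜 (w - u)) :=
        Submodule.mul_mem_mul (Submodule.mem_span_singleton_self a) hb
      rw [mul_left_comm] at h2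
      refine mul_le_mul_right (?_ : Submodule.span R {a} * 𝒜 (w - u) ≤ 𝒜 w) _ h2
      refine Submodule.mul_le.2 fun c hc d hd => ?_
      obtain ⟨r, rfl⟩ := Submodule.mem_span_singleton.1 hc
      rw [smul_mul_assoc]
      exact Submodule.smul_mem _ _ (hmul hd (by omega))
  · refine add_le_add (hlam.anti _ _ _ ?_) le_rfl
    have := sup_span_inf_le 𝒜 h𝔞 (huw.trans hwt) ha
    refine sup_le (this.trans (sup_le_sup le_sup_left le_rfl)) ?_
    exact le_sup_of_le_left le_sup_right

theorem growth_le_of_prime {lam : Submodule R A → Submodule R A → ℕ∞} (hlam : IsSubLength lam)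
    {E : Submodule R A} (hE : E ≤ 𝒜 1) {𝔞 : Ideal A}
    (h𝔞 : 𝔞.IsHomogeneous 𝒜) {w t : ℕ} (hwt : w + 1 ≤ t) {y : A} (hy1 : y ∈ 𝒜 1)
    (hy : y ∈ E ∨ E ≤ 𝔞.restrictScalars R) :
    growth 𝒜 lam E 𝔞 w (t + 1) ≤ growth 𝒜 lam E 𝔞 w t +
      growth 𝒜 lam E (𝔞 ⊔ Ideal.span {y}) w (t + 1) := by
  have hmul : ∀ {b : A}, b ∈ 𝒜 t → y * b ∈ 𝒜 (t + 1) := by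
    intro b hb
    rw [add_comm]
    exact SetLike.mul_mem_graded hy1 hb
  have hpow : E ^ (t - w) * 𝒜 w ≤ 𝒜 t := by
    have h1 : E ^ (t - w) ≤ 𝒜 (t - w) := by
      generalize t - w = n
      induction n with
      | zero => exact Submodule.one_le.2 SetLike.GradedOne.one_mem
      | succ n ih =>
        rw [pow_succ]
        exact Submodule.mul_le.2 fun a ha b hb => SetLike.mul_mem_graded (ih ha) (hE hb)
    refine Submodule.mul_le.2 fun a ha b hb => ?_
    have := SetLike.mul_mem_graded (h1 ha) hb
    rwa [Nat.sub_add_cancel (by omega)] at this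
  have hT : (𝒜 t).map (LinearMap.mulLeft R y) ≤ 𝒜 (t + 1) := by
    rintro _ ⟨b, hb, rfl⟩
    exact hmul hb
  rw [add_comm (growth 𝒜 lam E 𝔞 w t)]
  refine (hlam.sub y _ _ ((𝔞.restrictScalars R ⊓ 𝒜 t) ⊔ E ^ (t - w) * 𝒜 w) (𝒜 t) hT ?_).trans ?_
  · rw [Submodule.map_sup]
    refine sup_le ?_ ?_
    · rintro _ ⟨b, ⟨hb1, hb2⟩, rfl⟩
      exact Submodule.mem_sup_left ⟨𝔞.mul_mem_left y hb1, hmul hb2⟩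
    · rcases hy with hy | hy
      · refine le_sup_of_le_right ?_
        rintro _ ⟨b, hb, rfl⟩
        rw [show t + 1 - w = (t - w) + 1 by omega, pow_succ', mul_assoc]
        exact Submodule.mul_mem_mul hy hb
      · refine le_sup_of_le_left ?_
        rintro _ ⟨b, hb, rfl⟩
        refine ⟨?_, hmul (hpow hb)⟩
        have h3 : E ^ (t - w) * 𝒜 w ≤ 𝔞.restrictScalars R := by
          rw [show t - w = (t - w - 1) + 1 by omega, pow_succ', mul_assoc]
          exact Submodule.mul_le.2 fun c hc d hd => 𝔞.mul_mem_right d (hy hc)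
        exact 𝔞.mul_mem_left y (h3 hb)
  · refine add_le_add (hlam.anti _ _ _ ?_) le_rfl
    have := sup_span_inf_le 𝒜 h𝔞 (Nat.le_add_left 1 t) hy1
    rw [Nat.add_sub_cancel] at this
    refine sup_le (this.trans (sup_le_sup le_sup_left le_rfl)) ?_
    exact le_sup_of_le_left le_sup_right

/-- The growth of `lam (𝔞_t + E ^ (t - w) A_w) A_t` is controlled by the lengths of chains of
homogeneous primes containing `𝔞` and lying in `𝒢`, provided that it vanishes for the
homogeneous primes not in `𝒢`. -/
theorem growth_bound [IsNoetherianRing A] {lam : Submodule R A → Submodule R A → ℕ∞}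
    (hlam : IsSubLength lam) {E : Submodule R A} (hE : E ≤ 𝒜 1)
    (𝒢 : Set (PrimeSpectrum A)) (h𝒢 : ∀ p ∈ 𝒢, ¬ (𝒜 1 : Set A) ⊆ p.asIdeal) (𝔞₀ : Ideal A)
    (hfin : ∀ 𝔞 : Ideal A, 𝔞₀ ≤ 𝔞 → ∀ w t, w ≤ t → growth 𝒜 lam E 𝔞 w t ≠ ⊤)
    (hbad : ∀ p : PrimeSpectrum A, p.asIdeal.IsHomogeneous 𝒜 → 𝔞₀ ≤ p.asIdeal → p ∉ 𝒢 →
      ∃ w₀, ∀ w, w₀ ≤ w → ∀ᶠ t in atTop, growth 𝒜 lam E p.asIdeal w t = 0)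
    (𝔞 : Ideal A) (h𝔞 : 𝔞.IsHomogeneous 𝒜) (h𝔞₀ : 𝔞₀ ≤ 𝔞) (d : ℕ)
    (hd : ∀ s : LTSeries (PrimeSpectrum A), (∀ p ∈ s, p ∈ 𝒢 ∧ 𝔞 ≤ p.asIdeal) →
      s.length < d) :
    ∃ w₀, ∀ w, w₀ ≤ w → GrowthBounded d (growth 𝒜 lam E 𝔞 w) := by
  induction 𝔞 using IsNoetherian.induction generalizing d with
  | hgt 𝔞 ih =>
  change Ideal A at 𝔞
  by_cases htop : 𝔞 = ⊤
  · refine ⟨0, fun w _ => GrowthBounded.of_eventually_zero (Eventually.of_forall fun t => ?_)⟩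
    refine hlam.zero _ _ (le_sup_of_le_left ?_)
    subst htop
    intro z hz
    exact ⟨Submodule.mem_top, hz⟩
  by_cases hprime : 𝔞.IsPrime
  · by_cases hG : (⟨𝔞, hprime⟩ : PrimeSpectrum A) ∈ 𝒢
    · have h1 := hd (RelSeries.singleton _ ⟨𝔞, hprime⟩) (by
        rintro _ ⟨_, rfl⟩; exact ⟨hG, le_rfl⟩)
      obtain ⟨d, rfl⟩ : ∃ d', d = d' + 1 := ⟨d - 1, by simp at h1; omega⟩
      obtain ⟨y, hy1, hya, hyE⟩ : ∃ y ∈ 𝒜 1, y ∉ 𝔞 ∧ (y ∈ E ∨ E ≤ 𝔞.restrictScalars R) := by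
        by_cases hEa : E ≤ 𝔞.restrictScalars R
        · obtain ⟨y, hy, hya⟩ := Set.not_subset.1 (h𝒢 _ hG)
          exact ⟨y, hy, hya, Or.inr hEa⟩
        · obtain ⟨y, hy, hya⟩ := SetLike.not_le_iff_exists.1 hEa
          exact ⟨y, hE hy, hya, Or.inl hy⟩
      have hlt : 𝔞 < 𝔞 ⊔ Ideal.span {y} := by
        refine lt_of_le_of_ne le_sup_left fun h => hya ?_
        rw [h]
        exact Submodule.mem_sup_right (Ideal.mem_span_singleton_self y)
      obtain ⟨w₀, hw₀⟩ := ih _ hlt (h𝔞.sup (Ideal.homogeneous_span 𝒜 _ (by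
        rintro z rfl; exact ⟨1, hy1⟩))) (h𝔞₀.trans le_sup_left) d (by
          intro s hs
          have hlt' : (⟨𝔞, hprime⟩ : PrimeSpectrum A) < s.head :=
            show 𝔞 < s.head.asIdeal from hlt.trans_le (hs _ s.head_mem).2
          have := hd (s.cons ⟨𝔞, hprime⟩ hlt') (by
            intro p hp
            rw [← RelSeries.mem_toList, RelSeries.toList_cons, List.mem_cons,
              RelSeries.mem_toList] at hp
            rcases hp with rfl | hp
            · exact ⟨hG, le_rfl⟩
            · exact ⟨(hs p hp).1, le_sup_left.trans (hs p hp).2⟩)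
          simpa using this)
      refine ⟨w₀, fun w hw => GrowthBounded.of_step (hw₀ w hw) ?_ ?_⟩
      · filter_upwards [eventually_ge_atTop w] with t ht using hfin 𝔞 h𝔞₀ w t ht
      · filter_upwards [eventually_ge_atTop (w + 1)] with t ht
        exact growth_le_of_prime 𝒜 hlam hE h𝔞 ht hy1 hyE
    · obtain ⟨w₀, hw₀⟩ := hbad ⟨𝔞, hprime⟩ h𝔞 h𝔞₀ hG
      exact ⟨w₀, fun w hw => GrowthBounded.of_eventually_zero (hw₀ w hw)⟩
  · have : ∃ a b : A, SetLike.IsHomogeneousElem 𝒜 a ∧ a ∉ 𝔞 ∧ b ∉ 𝔞 ∧ a * b ∈ 𝔞 := by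
      by_contra! hcon
      refine hprime (h𝔞.isPrime_of_homogeneous_mem_or_mem htop ?_)
      intro a b ha hb hab
      by_contra! h2
      exact hcon a b ha h2.1 h2.2 hab
    obtain ⟨a, b, ⟨u, ha⟩, haa, hba, hab⟩ := this
    have hlt1 : 𝔞 < 𝔞 ⊔ Ideal.span {a} := by
      refine lt_of_le_of_ne le_sup_left fun h => haa ?_
      rw [h]
      exact Submodule.mem_sup_right (Ideal.mem_span_singleton_self a)
    have hlt2 : 𝔞 < Submodule.comap (LinearMap.mulLeft A a) 𝔞 := by
      refine lt_of_le_of_ne (fun z hz => 𝔞.mul_mem_left a hz) fun h => hba ?_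
      rw [h]
      exact hab
    obtain ⟨w₁, hw₁⟩ := ih _ hlt1 (h𝔞.sup (Ideal.homogeneous_span 𝒜 _ (by
        rintro z rfl; exact ⟨u, ha⟩))) (h𝔞₀.trans le_sup_left) d
        (fun s hs => hd s fun p hp => ⟨(hs p hp).1, le_sup_left.trans (hs p hp).2⟩)
    obtain ⟨w₂, hw₂⟩ := ih _ hlt2 (isHomogeneous_colon 𝒜 h𝔞 ha) (h𝔞₀.trans hlt2.le) d
        (fun s hs => hd s fun p hp => ⟨(hs p hp).1, hlt2.le.trans (hs p hp).2⟩)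
    refine ⟨max w₁ (w₂ + u), fun w hw => ?_⟩
    have hw1 : w₁ ≤ w := (le_max_left _ _).trans hw
    have hw2 : w₂ + u ≤ w := (le_max_right _ _).trans hw
    refine GrowthBounded.mono ((hw₁ w hw1).add ((hw₂ (w - u) (by omega)).shift (u := u))) ?_
    filter_upwards [eventually_ge_atTop w] with t ht
    exact growth_le_of_mem 𝒜 hlam h𝔞 (by omega) ht ha

end Growth

end GrowthBound

section Length

open TensorProduct

variable {R M N : Type*} [CommRing R] [AddCommGroup M] [Module R M] [AddCommGroup N] [Module R N]

/-- The length over a (flat) `R`-algebra `S` of the base change of `Q / (P ⊓ Q)`. -/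
def baseLength (S : Type*) [CommRing S] [Algebra R S] (P Q : Submodule R M) : ℕ∞ :=
  Module.length S (S ⊗[R] (↥Q ⧸ P.comap Q.subtype))

theorem baseLength_self (P Q : Submodule R M) : baseLength R P Q = colength R P Q := by
  rw [baseLength, colength, ← Module.length_eq_height]
  exact (TensorProduct.lid R (↥Q ⧸ P.comap Q.subtype)).length_eq

variable (S : Type*) [CommRing S] [Algebra R S]

theorem baseLength_eq_zero_of_le {P Q : Submodule R M} (h : Q ≤ P) : baseLength S P Q = 0 := by
  have : P.comap Q.subtype = ⊤ := by
    rw [Submodule.comap_subtype_eq_top]; exact h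
  have : Subsingleton (↥Q ⧸ P.comap Q.subtype) := Submodule.Quotient.subsingleton_iff.2 this
  rw [baseLength, Module.length_eq_zero_iff]
  infer_instance

/-- The map `T / (P ⊓ T) → T' / (P' ⊓ T')` induced by a linear map. -/
def subquotMap (f : M →ₗ[R] N) {P T : Submodule R M} {P' T' : Submodule R N}
    (hT : T ≤ T'.comap f) (hP : P ≤ P'.comap f) :
    (↥T ⧸ P.comap T.subtype) →ₗ[R] (↥T' ⧸ P'.comap T'.subtype) :=
  Submodule.mapQ _ _ (f.restrict (p := T) (q := T') hT) (fun _ hz => hP hz)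

theorem subquotMap_injective (f : M →ₗ[R] N) {P T : Submodule R M} {P' T' : Submodule R N}
    (hT : T ≤ T'.comap f) (hP : P ≤ P'.comap f) (h : ∀ z ∈ T, f z ∈ P' → z ∈ P) :
    Function.Injective (subquotMap f hT hP) := by
  rw [← LinearMap.ker_eq_bot, LinearMap.ker_eq_bot']
  intro z hz
  obtain ⟨z, rfl⟩ := Submodule.mkQ_surjective _ z
  rw [Submodule.mkQ_apply, Submodule.Quotient.mk_eq_zero]
  have : Submodule.Quotient.mk (f.restrict (p := T) (q := T') hT z) =
    (0 : ↥T' ⧸ P'.comap T'.subtype) := hz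
  rw [Submodule.Quotient.mk_eq_zero] at this
  exact h z z.2 this

theorem subquotMap_surjective (f : M →ₗ[R] N) {P T : Submodule R M} {P' T' : Submodule R N}
    (hT : T ≤ T'.comap f) (hP : P ≤ P'.comap f) (h : T' ≤ T.map f ⊔ P') :
    Function.Surjective (subquotMap f hT hP) := by
  intro z
  obtain ⟨⟨z, hz⟩, rfl⟩ := Submodule.mkQ_surjective _ z
  obtain ⟨_, ⟨y, hy, rfl⟩, p, hp, hz'⟩ := Submodule.mem_sup.1 (h hz)
  refine ⟨Submodule.Quotient.mk ⟨y, hy⟩, ?_⟩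
  change Submodule.Quotient.mk (f.restrict (p := T) (q := T') hT ⟨y, hy⟩) =
    Submodule.Quotient.mk _
  rw [Submodule.Quotient.eq]
  change f y - z ∈ P'
  rw [← hz']
  simpa using hp

theorem baseLength_le_of_surj (f : M →ₗ[R] N) {P T : Submodule R M} {P' T' : Submodule R N}
    (hT : T ≤ T'.comap f) (hP : P ≤ P'.comap f) (h : T' ≤ T.map f ⊔ P') :
    baseLength S P' T' ≤ baseLength S P T :=
  Module.length_le_of_surjective ((subquotMap f hT hP).baseChange S)
    (LinearMap.lTensor_surjective S (subquotMap_surjective f hT hP h))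

theorem baseLength_le_of_inj [Module.Flat R S] (f : M →ₗ[R] N) {P T : Submodule R M}
    {P' T' : Submodule R N}
    (hT : T ≤ T'.comap f) (hP : P ≤ P'.comap f) (h : ∀ z ∈ T, f z ∈ P' → z ∈ P) :
    baseLength S P T ≤ baseLength S P' T' :=
  Module.length_le_of_injective ((subquotMap f hT hP).baseChange S)
    (Module.Flat.lTensor_preserves_injective_linearMap _ (subquotMap_injective f hT hP h))

theorem baseLength_anti {P P' : Submodule R M} (Q : Submodule R M) (h : P ≤ P') :
    baseLength S P' Q ≤ baseLength S P Q :=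
  baseLength_le_of_surj S LinearMap.id (by simp) (by simpa using h) (by simp)

theorem baseLength_add [Module.Flat R S] {P Q T : Submodule R M} (hT : T ≤ Q) :
    baseLength S P Q = baseLength S (P ⊔ T) Q + baseLength S P T := by
  rw [add_comm]
  have h1 : Function.Injective (subquotMap (LinearMap.id : M →ₗ[R] M) (P := P) (P' := P)
    (T := T) (T' := Q) (by simpa using hT) (by simp)) :=
    subquotMap_injective _ _ _ fun z _ hz => hz
  have h2 : Function.Surjective (subquotMap (LinearMap.id : M →ₗ[R] M) (P := P) (P' := P ⊔ T)
    (T := Q) (T' := Q) (by simp) (by simp)) :=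
    subquotMap_surjective _ _ _ (by simp)
  refine Module.length_eq_add_of_exact (LinearMap.baseChange S _) (LinearMap.baseChange S _)
    (Module.Flat.lTensor_preserves_injective_linearMap _ h1)
    (LinearMap.lTensor_surjective S h2) ?_
  refine lTensor_exact S ?_ h2
  intro z
  constructor
  · intro hz
    obtain ⟨⟨z, hzQ⟩, rfl⟩ := Submodule.mkQ_surjective _ z
    have : Submodule.Quotient.mk ⟨z, hzQ⟩ = (0 : ↥Q ⧸ (P ⊔ T).comap Q.subtype) := hz
    rw [Submodule.Quotient.mk_eq_zero] at this
    obtain ⟨p, hp, y, hy, hz'⟩ := Submodule.mem_sup.1 (show z ∈ P ⊔ T from this)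
    refine ⟨Submodule.Quotient.mk ⟨y, hy⟩, ?_⟩
    change Submodule.Quotient.mk (⟨y, _⟩ : Q) = Submodule.Quotient.mk _
    rw [Submodule.Quotient.eq]
    change y - z ∈ P
    rw [← hz']
    simpa using hp
  · rintro ⟨z, rfl⟩
    obtain ⟨⟨z, hzT⟩, rfl⟩ := Submodule.mkQ_surjective _ z
    change Submodule.Quotient.mk (⟨z, _⟩ : Q) = (0 : ↥Q ⧸ (P ⊔ T).comap Q.subtype)
    rw [Submodule.Quotient.mk_eq_zero]
    exact Submodule.mem_sup_right hzT

theorem baseLength_mono [Module.Flat R S] {P Q Q' : Submodule R M} (h : Q ≤ Q') :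
    baseLength S P Q ≤ baseLength S P Q' :=
  baseLength_le_of_inj S LinearMap.id (by simpa using h) (by simp) fun _ _ h => h

theorem baseLength_isSubLength {A : Type*} [CommRing A] [Algebra R A] [Module.Flat R S] :
    IsSubLength (baseLength S : Submodule R A → Submodule R A → ℕ∞) where
  zero _ _ h := baseLength_eq_zero_of_le S h
  anti _ _ Q h := baseLength_anti S Q h
  sub a P Q P' T hT hP := by
    rw [baseLength_add S hT]
    refine add_le_add le_rfl ?_
    exact baseLength_le_of_surj S (LinearMap.mulLeft R a) (Submodule.le_comap_map _ _)
      (Submodule.map_le_iff_le_comap.1 hP) le_sup_left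

theorem baseLength_sup_right {P Q : Submodule R M} : baseLength S P (Q ⊔ P) = baseLength S P Q :=
  le_antisymm
    (baseLength_le_of_surj S LinearMap.id (by simp) (by simp) (by simp))
    (Module.length_le_of_surjective ((LinearEquiv.ofBijective
      (subquotMap (LinearMap.id : M →ₗ[R] M) (P := P) (P' := P) (T := Q) (T' := Q ⊔ P)
        (by simp) (by simp)) ⟨subquotMap_injective _ _ _ (fun _ _ h => h),
        subquotMap_surjective _ _ _ (by simp)⟩).symm.toLinearMap.baseChange S)
      (LinearMap.lTensor_surjective S (LinearEquiv.surjective _)))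

theorem baseLength_eq_zero_of_smul_mem {P Q : Submodule R M} {r : R}
    (hr : IsUnit (algebraMap R S r))
    (h : ∀ z ∈ Q, r • z ∈ P) : baseLength S P Q = 0 := by
  rw [baseLength, Module.length_eq_zero_iff]
  refine subsingleton_of_forall_eq 0 fun z => ?_
  induction z using TensorProduct.induction_on with
  | zero => rfl
  | add a b ha hb => rw [ha, hb, add_zero]
  | tmul s z =>
    obtain ⟨u, hu⟩ := hr
    obtain ⟨⟨z, hz⟩, rfl⟩ := Submodule.mkQ_surjective _ z
    have h1 : s = r • (s * (↑u⁻¹ : S)) := by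
      rw [Algebra.smul_def, ← hu, mul_left_comm, Units.mul_inv, mul_one]
    rw [h1, TensorProduct.smul_tmul]
    have : r • (P.comap Q.subtype).mkQ ⟨z, hz⟩ = 0 := by
      rw [← map_smul, Submodule.mkQ_apply, Submodule.Quotient.mk_eq_zero]
      exact h z hz
    rw [this, TensorProduct.tmul_zero]

/-- Finiteness of length for a finitely generated module killed by a power of the maximal ideal
of the local ring `S`. -/
theorem length_ne_top_of_pow_smul_eq_bot {S N : Type*} [CommRing S] [IsNoetherianRing S]
    [IsLocalRing S] [AddCommGroup N] [Module S N] [Module.Finite S N] (n : ℕ)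
    (h : ∀ a ∈ IsLocalRing.maximalIdeal S ^ n, ∀ z : N, a • z = 0) : Module.length S N ≠ ⊤ := by
  rcases subsingleton_or_nontrivial N with hN | hN
  · simp
  have hn : n ≠ 0 := by
    rintro rfl
    obtain ⟨z, hz⟩ := exists_ne (0 : N)
    exact hz (by simpa using h 1 (by simp) z)
  set I := IsLocalRing.maximalIdeal S ^ n with hI
  have hIm : I ≤ IsLocalRing.maximalIdeal S := Ideal.pow_le_self hn
  have : Nontrivial (S ⧸ I) := Ideal.Quotient.nontrivial_iff.2 fun h1 =>
    (IsLocalRing.maximalIdeal.isMaximal S).ne_top (top_le_iff.1 (h1 ▸ hIm))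
  have : IsLocalRing (S ⧸ I) :=
    IsLocalRing.of_surjective' (Ideal.Quotient.mk I) Ideal.Quotient.mk_surjective
  have htor : Module.IsTorsionBySet S N (I : Set S) := fun z a => h a.1 a.2 z
  let := htor.module
  have : IsScalarTower S (S ⧸ I) N := htor.isScalarTower
  have : IsArtinianRing (S ⧸ I) := by
    rw [isArtinianRing_iff_isNilpotent_maximalIdeal]
    refine ⟨n, le_bot_iff.1 ?_⟩
    have h1 : IsLocalRing.maximalIdeal (S ⧸ I) ≤
        (IsLocalRing.maximalIdeal S).map (Ideal.Quotient.mk I) := by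
      intro z hz
      obtain ⟨z, rfl⟩ := Ideal.Quotient.mk_surjective z
      refine Ideal.mem_map_of_mem _ fun hu => hz (hu.map _)
    refine (Ideal.pow_right_mono h1 n).trans ?_
    rw [← Ideal.map_pow, ← hI, Ideal.map_quotient_self]
  have : Module.Finite (S ⧸ I) N := Module.Finite.of_restrictScalars_finite S _ N
  rw [Module.length_eq_of_surjective (R := S ⧸ I) (S := S) Ideal.Quotient.mk_surjective]
  exact Module.length_ne_top

theorem exists_pow_smul_eq_zero_of_length_ne_top {S N : Type*} [CommRing S]
    [IsLocalRing S] [AddCommGroup N] [Module S N] (h : Module.length S N ≠ ⊤) :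
    ∃ n : ℕ, ∀ a ∈ IsLocalRing.maximalIdeal S ^ n, ∀ z : N, a • z = 0 := by
  rw [Module.length_ne_top_iff, isFiniteLength_iff_isNoetherian_isArtinian] at h
  obtain ⟨h1, h2⟩ := h
  let f : ℕ →o (Submodule S N)ᵒᵈ :=
    ⟨fun n => OrderDual.toDual (IsLocalRing.maximalIdeal S ^ n • (⊤ : Submodule S N)),
      fun a b hab =>
      Submodule.smul_mono_left (Ideal.pow_le_pow_right hab)⟩
  obtain ⟨n, hn⟩ := IsArtinian.monotone_stabilizes f
  have hn1 : IsLocalRing.maximalIdeal S ^ n • (⊤ : Submodule S N) =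
    IsLocalRing.maximalIdeal S ^ (n + 1) • (⊤ : Submodule S N) := hn (n + 1) (Nat.le_succ n)
  have hbot : IsLocalRing.maximalIdeal S ^ n • (⊤ : Submodule S N) = ⊥ := by
    refine Submodule.eq_bot_of_le_smul_of_le_jacobson_bot (IsLocalRing.maximalIdeal S) _
      (IsNoetherian.noetherian _) ?_ (IsLocalRing.maximalIdeal_le_jacobson _)
    rw [← mul_smul, ← pow_succ']
    exact hn1.le
  refine ⟨n, fun a ha z => ?_⟩
  have : a • z ∈ IsLocalRing.maximalIdeal S ^ n • (⊤ : Submodule S N) :=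
    Submodule.smul_mem_smul ha Submodule.mem_top
  rwa [hbot] at this

end Length

section Graded

variable {R A M : Type*} [CommRing R] [CommRing A] [Algebra R A]
  [AddCommGroup M] [Module R M] [Module A M] [IsScalarTower R A M]

theorem smulSM_eq_smul (I : Submodule R A) (N : Submodule R M) : smulSM I N = I • N := by
  refine le_antisymm (Submodule.span_le.2 ?_) (Submodule.smul_le.2 fun a ha m hm => ?_)
  · rintro _ ⟨a, ha, m, hm, rfl⟩
    exact Submodule.smul_mem_smul ha hm
  · exact Submodule.subset_span ⟨a, ha, m, hm, rfl⟩

theorem mul_smul_submodule (I I' : Submodule R A) (N : Submodule R M) :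
    (I * I') • N = I • (I' • N) :=
  Submodule.smul_assoc I I' N

theorem mem_span_singleton_smul {x : A} {N : Submodule R M} {z : M} :
    z ∈ Submodule.span R {x} • N ↔ ∃ m ∈ N, x • m = z := by
  constructor
  · intro hz
    refine Submodule.smul_induction_on hz ?_ ?_
    · intro a ha m hm
      obtain ⟨c, rfl⟩ := Submodule.mem_span_singleton.1 ha
      exact ⟨c • m, N.smul_mem c hm, by rw [smul_assoc, smul_algebra_smul_comm]⟩
    · rintro _ _ ⟨y, hy, rfl⟩ ⟨z, hz, rfl⟩
      exact ⟨y + z, N.add_mem hy hz, smul_add _ _ _⟩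
  · rintro ⟨m, hm, rfl⟩
    exact Submodule.smul_mem_smul (Submodule.mem_span_singleton_self x) hm

variable (𝒜 : ℕ → Submodule R A)

theorem piece_mul (hgen : ∀ n, 𝒜 n = 𝒜 1 ^ n) (a b : ℕ) : 𝒜 a * 𝒜 b = 𝒜 (a + b) := by
  rw [hgen a, hgen b, hgen (a + b), pow_add]

theorem piece_smul (hgen : ∀ n, 𝒜 n = 𝒜 1 ^ n) (ℳ : ℕ → Submodule R M)
    (hMdeg : ∀ n, ℳ n = smulSM (𝒜 n) (ℳ 0)) (a p : ℕ) : 𝒜 a • ℳ p = ℳ (a + p) := by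
  rw [hMdeg p, hMdeg (a + p), smulSM_eq_smul, smulSM_eq_smul, ← mul_smul_submodule,
    piece_mul 𝒜 hgen]

theorem pow_le_piece (hgen : ∀ n, 𝒜 n = 𝒜 1 ^ n) {E : Submodule R A} {s : ℕ} (hE : E ≤ 𝒜 s)
    (n : ℕ) : E ^ n ≤ 𝒜 (s * n) := by
  rw [hgen, pow_mul, ← hgen]
  exact pow_le_pow_left' hE n

theorem Ipow_le_piece (hgen : ∀ n, 𝒜 n = 𝒜 1 ^ n) {q : ℕ} {I : Fin q → Submodule R A}
    (hI : ∀ i, I i ≤ 𝒜 1) (r : Fin q → ℕ) : Ipow I r ≤ 𝒜 (∑ i, r i) := by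
  rw [hgen, Ipow, ← Finset.prod_pow_eq_pow_sum]
  exact Finset.prod_le_prod' fun i _ => pow_le_pow_left' (hI i) _

theorem isNoetherianRing_of_graded [IsNoetherianRing R] [GradedAlgebra 𝒜]
    (hgen : ∀ n, 𝒜 n = 𝒜 1 ^ n) (hfg : (𝒜 1).FG) : IsNoetherianRing A := by
  obtain ⟨s, hs⟩ := hfg
  have hft : Algebra.FiniteType R A := by
    refine ⟨⟨s, ?_⟩⟩
    have h1 : 𝒜 1 ≤ Subalgebra.toSubmodule (Algebra.adjoin R (s : Set A)) := by
      rw [← hs]; exact Submodule.span_le.2 Algebra.subset_adjoin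
    have h2 : ∀ n, 𝒜 n ≤ Subalgebra.toSubmodule (Algebra.adjoin R (s : Set A)) := by
      intro n
      rw [hgen]
      refine (pow_le_pow_left' h1 n).trans ?_
      induction n with
      | zero => rw [pow_zero]; exact Submodule.one_le.2 (Subalgebra.one_mem _)
      | succ n ih =>
        rw [pow_succ]
        exact Submodule.mul_le.2 fun a ha b hb => Subalgebra.mul_mem _ (ih ha) hb
    rw [eq_top_iff]
    have h3 : (⨆ n, 𝒜 n) = ⊤ := (DirectSum.Decomposition.isInternal 𝒜).submodule_iSup_eq_top
    have h4 := iSup_le h2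
    rw [h3] at h4
    exact fun z _ => h4 Submodule.mem_top
  exact Algebra.FiniteType.isNoetherianRing R A

/-- A homogeneous element of `xM` is `x` times a homogeneous element. -/
theorem exists_homogeneous_of_smul_mem (hgen : ∀ n, 𝒜 n = 𝒜 1 ^ n) (ℳ : ℕ → Submodule R M)
    (hMint : DirectSum.IsInternal ℳ) (hMdeg : ∀ n, ℳ n = smulSM (𝒜 n) (ℳ 0)) {x : A}
    (hx : x ∈ 𝒜 1) {d : ℕ} {m : M} (hm : x • m ∈ ℳ (d + 1)) : ∃ y ∈ ℳ d, x • m = x • y := by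
  let := hMint.chooseDecomposition
  have key : ∀ m : M, ∃ y ∈ ℳ d, (DirectSum.decompose ℳ (x • m) (d + 1) : M) = x • y := by
    intro m
    induction m using DirectSum.Decomposition.inductionOn ℳ with
    | zero => exact ⟨0, zero_mem _, by simp⟩
    | @homogeneous k m =>
      have hxm : x • (m : M) ∈ ℳ (k + 1) := by
        rw [add_comm, ← piece_smul 𝒜 hgen ℳ hMdeg]
        exact Submodule.smul_mem_smul hx m.2
      by_cases hk : k = d
      · subst hk
        exact ⟨m, m.2, DirectSum.decompose_of_mem_same ℳ hxm⟩
      · exact ⟨0, zero_mem _, by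
          rw [DirectSum.decompose_of_mem_ne ℳ hxm (by omega), smul_zero]⟩
    | add a b ha hb =>
      obtain ⟨y, hy, h1⟩ := ha
      obtain ⟨z, hz, h2⟩ := hb
      refine ⟨y + z, add_mem hy hz, ?_⟩
      rw [smul_add, DirectSum.decompose_add, DirectSum.add_apply, Submodule.coe_add, h1, h2,
        smul_add]
  obtain ⟨y, hy, h⟩ := key m
  exact ⟨y, hy, by rw [← h, DirectSum.decompose_of_mem_same ℳ hm]⟩

/-- By the Artin-Rees lemma, a high power of `𝓘` times `M` meets the `𝓘`-power torsion of `M`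
trivially. -/
theorem exists_pow_smul_inf_sat_eq_bot [IsNoetherianRing A] [Module.Finite A M] (𝓘 : Ideal A) :
    ∃ n : ℕ, 𝓘 ^ n • (⊤ : Submodule A M) ⊓ sat 𝓘 (⊥ : Submodule A M) = ⊥ := by
  let f : ℕ →o Submodule A M :=
    ⟨fun k => ⨅ a ∈ 𝓘 ^ k, (⊥ : Submodule A M).comap (LinearMap.lsmul A M a), by
      intro k l hkl
      exact le_iInf₂ fun a ha => iInf₂_le a (Ideal.pow_le_pow_right hkl ha)⟩
  obtain ⟨k, hk⟩ : ∃ k, sat 𝓘 (⊥ : Submodule A M) ≤ f k := by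
    obtain ⟨k, hk⟩ := monotone_stabilizes_iff_noetherian.2 (inferInstance : IsNoetherian A M) f
    refine ⟨k, iSup_le fun l => ?_⟩
    rcases le_total l k with h | h
    · exact f.mono h
    · exact (hk l h).ge
  obtain ⟨c, hc⟩ := Ideal.exists_pow_inf_eq_pow_smul 𝓘 (sat 𝓘 (⊥ : Submodule A M))
  refine ⟨k + c, ?_⟩
  rw [hc (k + c) (by omega), Nat.add_sub_cancel, eq_bot_iff]
  refine Submodule.smul_le.2 fun a ha z hz => ?_
  have h1 := hk hz.2
  have h2 : f k ≤ (⊥ : Submodule A M).comap (LinearMap.lsmul A M a) := iInf₂_le a ha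
  exact h2 h1

theorem Ipow_smul_le {q : ℕ} (I : Fin q → Submodule R A) {n : ℕ} {r : Fin q → ℕ}
    (hr : ∀ i, n ≤ r i) (N : Submodule R M) :
    Ipow I r • N ≤ (idealGen I ^ n • (⊤ : Submodule A M)).restrictScalars R := by
  have h1 : Ipow I r = (∏ i, I i) ^ n * Ipow I (fun i => r i - n) := by
    rw [Ipow, Ipow, ← Finset.prod_pow, ← Finset.prod_mul_distrib]
    exact Finset.prod_congr rfl fun i _ => by rw [← pow_add, Nat.add_sub_cancel' (hr i)]
  have h2 : ∀ n, (∏ i, I i) ^ n ≤ (idealGen I ^ n).restrictScalars R := by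
    intro n
    induction n with
    | zero => rw [pow_zero, pow_zero, Ideal.one_eq_top]; exact fun _ _ => Submodule.mem_top
    | succ n ih =>
      rw [pow_succ]
      refine Submodule.mul_le.2 fun a ha b hb => ?_
      rw [Submodule.restrictScalars_mem, pow_succ]
      exact Ideal.mul_mem_mul (ih ha) (Ideal.subset_span hb)
  rw [h1, mul_smul_submodule]
  refine Submodule.smul_le.2 fun a ha m _ => ?_
  rw [Submodule.restrictScalars_mem]
  exact Submodule.smul_mem_smul (h2 n ha) Submodule.mem_top

theorem Ipow_cons {q : ℕ} (J : Submodule R A) (I : Fin q → Submodule R A) (n : ℕ)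
    (r : Fin q → ℕ) :
    Ipow (Fin.cons J I : Fin (q + 1) → Submodule R A) (Fin.cons n r : Fin (q + 1) → ℕ) =
      J ^ n * Ipow I r := by
  simp [Ipow, Fin.prod_univ_succ]

theorem le_mul_Ipow_update {q : ℕ} (I : Fin q → Submodule R A) (i : Fin q) {r : Fin q → ℕ}
    (hr : 0 < r i) : I i * Ipow I (Function.update r i (r i - 1)) = Ipow I r := by
  rw [Ipow, Ipow, ← Finset.mul_prod_erase _ _ (Finset.mem_univ i),
    ← Finset.mul_prod_erase _ (fun l => I l ^ r l) (Finset.mem_univ i), ← mul_assoc,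
    Function.update_self, ← pow_succ', Nat.sub_add_cancel hr]
  congr 1
  refine Finset.prod_congr rfl fun l hl => ?_
  rw [Function.update_of_ne (Finset.ne_of_mem_erase hl)]

theorem mixedLen_eq {q : ℕ} (J : Submodule R A) (I : Fin q → Submodule R A)
    (ℳ : ℕ → Submodule R M) (n p : ℕ) (r : Fin q → ℕ) :
    mixedLen J I ℳ n p r = baseLength R ((J ^ n * Ipow I r) • ℳ p) (Ipow I r • ℳ (n + p)) := by
  rw [mixedLen, baseLength_self, smulSM_eq_smul, smulSM_eq_smul]

theorem map_mkQ_smul (E : Submodule R A) (L : Submodule R M) (N : Submodule A M) :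
    E • L.map (N.mkQ.restrictScalars R) = (E • L).map (N.mkQ.restrictScalars R) := by
  refine le_antisymm (Submodule.smul_le.2 ?_) (Submodule.map_le_iff_le_comap.2
    (Submodule.smul_le.2 ?_))
  · rintro a ha _ ⟨m, hm, rfl⟩
    exact ⟨a • m, Submodule.smul_mem_smul ha hm, by simp⟩
  · intro a ha m hm
    have : a • N.mkQ m ∈ E • L.map (N.mkQ.restrictScalars R) :=
      Submodule.smul_mem_smul ha ⟨m, hm, rfl⟩
    simpa using this

/-- The difference identity for the Hilbert function along a weak (FC)-element. -/
theorem mixedLen_eq_add [IsNoetherianRing R] [IsLocalRing R] [GradedAlgebra 𝒜]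
    (hgen : ∀ n, 𝒜 n = 𝒜 1 ^ n) (hGfg : (𝒜 1).FG)
    (ℳ : ℕ → Submodule R M) (hMint : DirectSum.IsInternal ℳ)
    (hMdeg : ∀ n, ℳ n = smulSM (𝒜 n) (ℳ 0)) [Module.Finite A M]
    {q : ℕ} (I : Fin q → Submodule R A) (hI1 : ∀ i, I i ≤ 𝒜 1)
    (J : Submodule R A) (hJ1 : J ≤ 𝒜 1) (i : Fin q) (x : A)
    (hx : IsWeakFCElemAt R ℳ (Fin.cons J I) (idealGen I) i.succ x ⊥ (⊥ : Submodule A M)) :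
    ∃ N : ℕ, ∀ (n p : ℕ) (r : Fin q → ℕ), (∀ l, N ≤ r l) →
      mixedLen J I ℳ n p r = mixedLen J I (quotPieces ℳ (spanM {x})) n p r +
        mixedLen J I ℳ n p (Function.update r i (r i - 1)) := by
  have : IsNoetherianRing A := isNoetherianRing_of_graded 𝒜 hgen hGfg
  obtain ⟨hxI, -, ⟨ri, hri, hFC1⟩, hFC2⟩ := hx
  simp only [Fin.cons_succ] at hxI
  obtain ⟨c, hc⟩ := exists_pow_smul_inf_sat_eq_bot (M := M) (idealGen I)
  have hx1 : x ∈ 𝒜 1 := hI1 i hxI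
  refine ⟨max ri (c + 1), fun n p r hr => ?_⟩
  have hri' : ri ≤ r i := (le_max_left _ _).trans (hr i)
  have hc' : ∀ l, c + 1 ≤ r l := fun l => (le_max_right _ _).trans (hr l)
  set r' := Function.update r i (r i - 1) with hr'
  have hFC : ∀ n p, (J ^ n * Ipow I r) • ℳ p ⊓
      Submodule.span R {x} • ℳ (n + ∑ l, r l + p - 1) =
      Submodule.span R {x} • ((J ^ n * Ipow I r') • ℳ p) := by
    intro n p
    have := hFC1 p (Fin.cons n r) (by simpa using hri')
    rw [← Fin.cons_update, Fin.cons_succ, ← hr', Ipow_cons, Ipow_cons] at this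
    simpa [smulSM_eq_smul, Fin.sum_univ_succ, mul_smul_submodule] using this
  have hIr : I i * Ipow I r' = Ipow I r := le_mul_Ipow_update I i (by have := hc' i; omega)
  set Q := Ipow I r • ℳ (n + p) with hQ
  set P := (J ^ n * Ipow I r) • ℳ p with hP
  set Q' := Ipow I r' • ℳ (n + p) with hQ'
  set P' := (J ^ n * Ipow I r') • ℳ p with hP'
  have hJM : J ^ n • ℳ p ≤ ℳ (n + p) := by
    rw [← piece_smul 𝒜 hgen ℳ hMdeg]
    refine Submodule.smul_mono_left ?_
    rw [hgen]; exact pow_le_pow_left' hJ1 n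
  have hPQ : P ≤ Q := by
    rw [hP, hQ, mul_comm, mul_smul_submodule]; exact smul_mono_right _ hJM
  have hPQ' : P' ≤ Q' := by
    rw [hP', hQ', mul_comm, mul_smul_submodule]; exact smul_mono_right _ hJM
  obtain ⟨e, he⟩ : ∃ e, ∑ l, r l = e + 1 :=
    ⟨∑ l, r l - 1, by
      have h1 := Finset.single_le_sum (f := r) (fun _ _ => Nat.zero_le _) (Finset.mem_univ i)
      have h2 := hc' i
      omega⟩
  have hQdeg : Q ≤ ℳ (e + (n + p) + 1) := by
    rw [show e + (n + p) + 1 = ∑ l, r l + (n + p) by omega, ← piece_smul 𝒜 hgen ℳ hMdeg]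
    exact Submodule.smul_mono_left (Ipow_le_piece 𝒜 hgen hI1 r)
  have hxQ' : Submodule.span R {x} • Q' ≤ Q := by
    rw [hQ', hQ, ← hIr, mul_smul_submodule]
    exact Submodule.smul_mono_left ((Submodule.span_singleton_le_iff_mem _ _).2 hxI)
  have hxP' : Submodule.span R {x} • P' ≤ P := by
    rw [← hFC n p]; exact inf_le_left
  have hPx : ∀ z, z ∈ P → ∀ m, z = x • m → ∃ y ∈ P', x • m = x • y := by
    rintro z hz m rfl
    obtain ⟨y, hy, h⟩ := exists_homogeneous_of_smul_mem 𝒜 hgen ℳ hMint hMdeg hx1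
      (hQdeg (hPQ hz))
    have h2 : x • m ∈ Submodule.span R {x} • P' := by
      rw [← hFC n p]
      refine ⟨hz, mem_span_singleton_smul.2 ⟨y, ?_, h.symm⟩⟩
      rwa [show n + ∑ l, r l + p - 1 = e + (n + p) by omega]
    obtain ⟨y, hy, h⟩ := mem_span_singleton_smul.1 h2
    exact ⟨y, hy, h.symm⟩
  have hQx : ∀ z, z ∈ Q → ∀ m, z = x • m → z ∈ Submodule.span R {x} • Q' := by
    rintro z hz m rfl
    obtain ⟨y, hy, h⟩ := exists_homogeneous_of_smul_mem 𝒜 hgen ℳ hMint hMdeg hx1 (hQdeg hz)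
    have := hFC 0 (n + p)
    rw [pow_zero, one_mul, one_mul] at this
    rw [hQ', ← this]
    refine ⟨hz, mem_span_singleton_smul.2 ⟨y, ?_, h.symm⟩⟩
    rwa [show 0 + ∑ l, r l + (n + p) - 1 = e + (n + p) by omega]
  have htors : ∀ z ∈ Q', x • z = 0 → z = 0 := by
    intro z hz hxz
    have h1 : z ∈ sat (idealGen I) (⊥ : Submodule A M) := hFC2 hxz
    have h2 : z ∈ idealGen I ^ c • (⊤ : Submodule A M) := Ipow_smul_le I (n := c) (by
      intro l
      have := hc' l
      have := hc' i
      rw [hr']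
      by_cases hl : l = i
      · subst hl; rw [Function.update_self]; omega
      · rw [Function.update_of_ne hl]; omega) _ hz
    have h3 : z ∈ idealGen I ^ c • (⊤ : Submodule A M) ⊓ sat (idealGen I) ⊥ := ⟨h2, h1⟩
    rwa [hc] at h3
  rw [mixedLen_eq, mixedLen_eq, mixedLen_eq, baseLength_add R hxQ']
  let f : M →ₗ[R] M := (LinearMap.lsmul A M x).restrictScalars R
  congr 1
  · have h1 : (J ^ n * Ipow I r) • quotPieces ℳ (spanM {x}) p =
        P.map ((spanM {x} : Submodule A M).mkQ.restrictScalars R) := map_mkQ_smul _ _ _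
    have h2 : Ipow I r • quotPieces ℳ (spanM {x}) (n + p) =
        Q.map ((spanM {x} : Submodule A M).mkQ.restrictScalars R) := map_mkQ_smul _ _ _
    rw [h1, h2]
    have hmem : ∀ m : M, m ∈ (spanM {x} : Submodule A M) ↔ ∃ y, m = x • y := by
      intro m
      rw [spanM, Submodule.ideal_span_singleton_smul, Submodule.mem_smul_pointwise_iff_exists]
      simp [eq_comm]
    have hle : P ⊔ Submodule.span R {x} • Q' ≤
        (P.map ((spanM {x} : Submodule A M).mkQ.restrictScalars R)).comap
          ((spanM {x} : Submodule A M).mkQ.restrictScalars R) := by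
      refine sup_le (Submodule.le_comap_map _ _) ?_
      intro z hz
      obtain ⟨y, -, rfl⟩ := mem_span_singleton_smul.1 hz
      have : (spanM {x} : Submodule A M).mkQ (x • y) = 0 := by
        rw [Submodule.mkQ_apply, Submodule.Quotient.mk_eq_zero, hmem]
        exact ⟨y, rfl⟩
      rw [Submodule.mem_comap, LinearMap.restrictScalars_apply, this]
      exact zero_mem _
    refine le_antisymm ?_ ?_
    · refine baseLength_le_of_inj R ((spanM {x} : Submodule A M).mkQ.restrictScalars R)
        (Submodule.le_comap_map _ _) hle ?_
      rintro z hz ⟨y, hy, hyz⟩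
      have : y - z ∈ (spanM {x} : Submodule A M) := (Submodule.Quotient.eq _).1 hyz
      obtain ⟨w, hw⟩ := (hmem _).1 this
      have h3 := hQx _ (Q.sub_mem (hPQ hy) hz) w hw
      have h4 := Submodule.sub_mem_sup hy h3
      rwa [sub_sub_cancel] at h4
    · exact baseLength_le_of_surj R ((spanM {x} : Submodule A M).mkQ.restrictScalars R)
        (Submodule.le_comap_map _ _) hle le_sup_left
  · have hf : Q'.map f = Submodule.span R {x} • Q' := by
      ext z
      rw [mem_span_singleton_smul]
      rfl
    have hfP : P' ≤ P.comap f := fun z hz => hxP' (mem_span_singleton_smul.2 ⟨z, hz, rfl⟩)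
    rw [← hf]
    refine le_antisymm ?_ ?_
    · exact baseLength_le_of_surj R f (Submodule.le_comap_map _ _) hfP le_sup_left
    · refine baseLength_le_of_inj R f (Submodule.le_comap_map _ _) hfP ?_
      intro z hz hfz
      obtain ⟨y, hy, h⟩ := hPx (x • z) hfz z rfl
      have h5 := htors (z - y) (Q'.sub_mem hz (hPQ' hy)) (by rw [smul_sub, h, sub_self])
      rw [sub_eq_zero.1 h5]
      exact hy

end Graded

section Shift
open MvPolynomial

variable {σ : Type*} [DecidableEq σ]

/-- The substitution `X i ↦ X i - 1`. -/
def shift (i : σ) : MvPolynomial σ ℚ →ₐ[ℚ] MvPolynomial σ ℚ :=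
  aeval fun l => if l = i then X l - 1 else X l

lemma eval_shift (i : σ) (v : σ → ℚ) (P : MvPolynomial σ ℚ) :
    eval v (shift i P) = eval (Function.update v i (v i - 1)) P := by
  rw [shift, ← coe_aeval_eq_eval, ← coe_aeval_eq_eval, RingHom.coe_coe, RingHom.coe_coe,
    ← AlgHom.comp_apply]
  congr 1
  ext l
  by_cases h : l = i
  · subst h; simp
  · simp [h]

lemma shift_monomial (i : σ) (s : σ →₀ ℕ) (a : ℚ) :
    shift i (monomial s a) = ∑ k ∈ Finset.range (s i + 1),
      monomial (s.erase i + Finsupp.single i k) (a * ((-1) ^ (s i - k) * (s i).choose k)) := by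
  have h1 : (monomial s a : MvPolynomial σ ℚ) = monomial (s.erase i) a * X i ^ s i := by
    rw [X_pow_eq_monomial, monomial_mul, mul_one, Finsupp.erase_add_single]
  have h2 : shift i (monomial (s.erase i) a) = monomial (s.erase i) a := by
    rw [shift, aeval_monomial, monomial_eq]
    congr 1
    refine Finsupp.prod_congr fun l hl => ?_
    have : l ≠ i := by rintro rfl; simp at hl
    simp [this]
  rw [h1, map_mul, h2, map_pow]
  have h3 : shift i (X i : MvPolynomial σ ℚ) = X i + C (-1) := by simp [shift, sub_eq_add_neg]
  rw [h3, add_pow, Finset.mul_sum]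
  refine Finset.sum_congr rfl fun k _ => ?_
  rw [X_pow_eq_monomial, ← C_pow, ← C_eq_coe_nat, mul_assoc, ← C_mul, mul_comm _ (C _),
    C_mul_monomial, monomial_mul, mul_one]

lemma coeff_sub_shift_monomial (i : σ) (m s : σ →₀ ℕ) (a : ℚ)
    (hs : s.degree ≤ m.degree + 1) :
    coeff m (monomial s a - shift i (monomial s a)) =
      (m i + 1) * coeff (m + Finsupp.single i 1) (monomial s a) := by
  rw [shift_monomial, coeff_sub, coeff_sum]
  simp only [coeff_monomial]
  by_cases he : s.erase i = m.erase i
  · have hsm : ∀ k, s.erase i + Finsupp.single i k = m ↔ k = m i := by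
      intro k
      rw [he]
      constructor
      · intro h
        have := DFunLike.congr_fun h i
        simpa using this
      · rintro rfl
        exact Finsupp.erase_add_single i m
    have hdeg : ∀ u : σ →₀ ℕ, u.degree = (u.erase i).degree + u i := fun u => by
      conv_lhs => rw [← Finsupp.erase_add_single i u]
      simp
    have hsi : s i ≤ m i + 1 := by
      have h1 := hdeg s
      have h2 := hdeg m
      rw [he] at h1
      omega
    have hs' : ∀ u : σ →₀ ℕ, u.erase i = s.erase i → (s = u ↔ s i = u i) := by
      intro u hu
      constructor
      · rintro rfl; rfl
      · intro h
        rw [← Finsupp.erase_add_single i s, ← Finsupp.erase_add_single i u, hu, h]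
    simp only [hsm, hs' m he.symm]
    simp only [hs' (m + Finsupp.single i 1) (by rw [he]; ext l; by_cases h : l = i <;> simp [h])]
    simp only [Finsupp.add_apply, Finsupp.single_eq_same, Finset.sum_ite_eq', Finset.mem_range]
    rcases (by omega : s i < m i ∨ s i = m i ∨ s i = m i + 1) with h | h | h
    · rw [if_neg (by omega), if_neg (by omega), if_neg (by omega)]; simp
    · rw [if_pos h, if_pos (by omega), if_neg (by omega), h]; simp
    · rw [if_neg (by omega), if_pos (by omega), if_pos (by omega), h]
      simp; ring
  · have hl : ∀ u : σ →₀ ℕ, u.erase i = m.erase i → s ≠ u := by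
      rintro u hu rfl; exact he hu
    rw [if_neg (hl m rfl), if_neg (hl _ (by ext l; by_cases h : l = i <;> simp [h])),
      Finset.sum_eq_zero]
    · simp
    · intro k _
      rw [if_neg]
      intro h
      apply he
      rw [← h]
      ext l; by_cases h : l = i <;> simp [h]

lemma coeff_sub_shift [Fintype σ] (i : σ) (m : σ →₀ ℕ) (P : MvPolynomial σ ℚ)
    (hP : P.totalDegree ≤ m.degree + 1) :
    coeff m (P - shift i P) = (m i + 1) * coeff (m + Finsupp.single i 1) P := by
  conv_lhs => rw [P.as_sum]
  conv_rhs => rw [P.as_sum]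
  rw [map_sum, ← Finset.sum_sub_distrib, coeff_sum, coeff_sum, Finset.mul_sum]
  refine Finset.sum_congr rfl fun s hs => coeff_sub_shift_monomial i m s _ ?_
  refine le_trans ?_ hP
  have := le_totalDegree hs
  rwa [Finsupp.degree_eq_sum, ← Finsupp.sum_fintype _ (fun _ e => e) (by simp)]

end Shift

lemma vals_update {q : ℕ} (n p : ℕ) (r : Fin q → ℕ) (i : Fin q) (hr : 1 ≤ r i) :
    vals n p (Function.update r i (r i - 1)) =
      Function.update (vals n p r) i.succ.succ (vals n p r i.succ.succ - 1) := by
  funext l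
  refine Fin.cases ?_ (fun l => Fin.cases ?_ (fun l => ?_) l) l
  · rw [Function.update_of_ne (Fin.succ_ne_zero _).symm]; rfl
  · rw [Function.update_of_ne]
    · rfl
    · intro h
      exact (Fin.succ_ne_zero _).symm (Fin.succ_injective _ h)
  · by_cases h : l = i
    · subst h
      simp [vals, hr]
    · rw [Function.update_of_ne (fun h' => h (Fin.succ_injective _ (Fin.succ_injective _ h')))]
      simp [vals, h]

lemma mv_eq_of_eval_vals {q : ℕ} (P Q : MvPolynomial (Fin (q + 2)) ℚ) (N : ℕ)
    (h : ∀ n p r, N ≤ n → N ≤ p → (∀ l, N ≤ r l) →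
      MvPolynomial.eval (vals n p r) P = MvPolynomial.eval (vals n p r) Q) : P = Q := by
  refine MvPolynomial.funext_set (fun _ => (Nat.cast : ℕ → ℚ) '' Set.Ici N)
    (fun _ => (Set.Ici_infinite N).image Nat.cast_injective.injOn) fun v hv => ?_
  have hv' : ∀ l, ∃ n : ℕ, N ≤ n ∧ (n : ℚ) = v l := fun l => hv l (Set.mem_univ _)
  choose u hu huv using hv'
  have : v = vals (u 0) (u 1) (fun l => u l.succ.succ) := by
    funext l
    refine Fin.cases ?_ (fun l => Fin.cases ?_ (fun l => ?_) l) l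
    · exact (huv 0).symm
    · exact (huv 1).symm
    · exact (huv _).symm
  rw [this]
  exact h _ _ _ (hu _) (hu _) (fun _ => hu _)

lemma mixedCoeff_eq_of_sub_shift {q : ℕ} (P P' : MvPolynomial (Fin (q + 2)) ℚ) (i : Fin q)
    (h : P = P' + shift i.succ.succ P) (k0 j : ℕ) (k : Fin q → ℕ) (hki : 0 < k i)
    (hP : P.totalDegree ≤ k0 + j + ∑ i, k i) :
    mixedCoeff P k0 j k = mixedCoeff P' k0 j (Function.update k i (k i - 1)) := by
  obtain ⟨e, he⟩ : ∃ e, k i = e + 1 := ⟨k i - 1, by omega⟩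
  set k' := Function.update k i (k i - 1) with hk'
  have hkk' : k = Function.update k' i (k' i + 1) := by
    rw [hk']; funext l; by_cases hl : l = i
    · subst hl; simp; omega
    · simp [hl]
  have hk'i : k' i = e := by simp [hk', he]
  have hPP : P' = P - shift i.succ.succ P := eq_sub_of_add_eq h.symm
  set m : Fin (q+2) →₀ ℕ := Finsupp.equivFunOnFinite.symm (Fin.cons k0 (Fin.cons j k')) with hm
  have hm1 : Finsupp.equivFunOnFinite.symm (Fin.cons k0 (Fin.cons j k)) =
      m + Finsupp.single i.succ.succ 1 := by
    ext l
    simp only [hm, Finsupp.add_apply, Finsupp.equivFunOnFinite_symm_apply_apply]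
    refine Fin.cases ?_ (fun l => Fin.cases ?_ (fun l => ?_) l) l
    · rw [Finsupp.single_eq_of_ne (Fin.succ_ne_zero _).symm]; rfl
    · rw [Finsupp.single_eq_of_ne]
      · rfl
      · intro h
        exact (Fin.succ_ne_zero _).symm (Fin.succ_injective _ h)
    · by_cases h : l = i
      · subst h
        simp [hk'i, he]
      · rw [Finsupp.single_eq_of_ne
          (fun h' => h (Fin.succ_injective _ (Fin.succ_injective _ h')))]
        simp [hk', h]
  have hsum : ∑ l, k l = ∑ l, k' l + 1 := by
    rw [← Finset.add_sum_erase _ k (Finset.mem_univ i),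
      ← Finset.add_sum_erase _ k' (Finset.mem_univ i),
      he, hk'i, Finset.sum_congr rfl (g := k')]
    · ring
    · intro l hl
      simp [hk', Finset.ne_of_mem_erase hl]
  have hmd : m.degree = k0 + j + ∑ l, k' l := by
    rw [Finsupp.degree_eq_sum, Fin.sum_univ_succ, Fin.sum_univ_succ]
    simp [hm, add_assoc]
  have hc := coeff_sub_shift i.succ.succ m P (by rw [hmd]; omega)
  have hmi : m i.succ.succ = e := by simp [hm, hk'i]
  have hprod : (∏ l, ((k l).factorial : ℚ)) = (e + 1) * ∏ l, ((k' l).factorial : ℚ) := by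
    rw [← Finset.mul_prod_erase _ _ (Finset.mem_univ i),
      ← Finset.mul_prod_erase _ (fun l => ((k' l).factorial : ℚ)) (Finset.mem_univ i),
      he, hk'i, Nat.factorial_succ, Finset.prod_congr rfl (g := fun l => ((k' l).factorial : ℚ))]
    · push_cast; ring
    · intro l hl
      simp [hk', Finset.ne_of_mem_erase hl]
  rw [mixedCoeff, mixedCoeff, hm1, hPP, hc, hmi, Nat.cast_prod, Nat.cast_prod, hprod]
  ring

section Lift

variable {R A : Type*} [CommRing R] [CommRing A] [Algebra R A]

lemma decompose_mem_smul_piece (𝒜 : ℕ → Submodule R A) [GradedAlgebra 𝒜] (𝔭 : Ideal R) {z : A}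
    (hz : z ∈ 𝔭.map (algebraMap R A)) (n : ℕ) :
    (DirectSum.decompose 𝒜 z n : A) ∈ 𝔭 • 𝒜 n := by
  have hz' : z ∈ 𝔭 • (⊤ : Submodule R A) := by
    rw [Ideal.smul_top_eq_map]; exact hz
  refine Submodule.smul_induction_on hz' ?_ ?_
  · intro r hr a _
    have : (DirectSum.decompose 𝒜 (r • a) n : A) = r • (DirectSum.decompose 𝒜 a n : A) := by
      rw [DirectSum.decompose_smul]; rfl
    rw [this]
    exact Submodule.smul_mem_smul hr (SetLike.coe_mem _)
  · intro a b ha hb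
    have : (DirectSum.decompose 𝒜 (a + b) n : A) =
        (DirectSum.decompose 𝒜 a n : A) + (DirectSum.decompose 𝒜 b n : A) := by
      simp
    rw [this]
    exact add_mem ha hb

lemma exists_smul_le_of_smul_le_sup (𝔭 : Ideal R) [𝔭.IsPrime] {M : Type*} [AddCommGroup M]
    [Module R M] [Module.Finite R M] (r : R) (hr : r ∉ 𝔭)
    (h : ∀ z : M, r • z ∈ 𝔭 • (⊤ : Submodule R M)) : ∃ s, s ∉ 𝔭 ∧ ∀ z : M, s • z = 0 := by
  obtain ⟨p, hp, -, hc, h0⟩ :=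
    LinearMap.exists_monic_and_natDegree_eq_and_coeff_mem_pow_and_aeval_eq_zero R
      (algebraMap R (Module.End R M) r) 𝔭 (by rintro _ ⟨z, rfl⟩; exact h z)
  refine ⟨p.eval r, fun hmem => ?_, fun z => ?_⟩
  · rw [Polynomial.eval_eq_sum_range, Finset.sum_range_succ, hp.coeff_natDegree, one_mul] at hmem
    have h1 : ∑ x ∈ Finset.range p.natDegree, p.coeff x * r ^ x ∈ 𝔭 := by
      refine Ideal.sum_mem _ fun k hk => Ideal.mul_mem_right _ _ ?_
      have hk' := Finset.mem_range.mp hk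
      exact Ideal.pow_le_self (by omega) (hc k)
    exact hr (Ideal.IsPrime.mem_of_pow_mem ‹_› _ ((Ideal.add_mem_iff_right _ h1).mp hmem))
  · rw [Polynomial.aeval_algebraMap_apply, Polynomial.coe_aeval_eq_eval] at h0
    simpa using LinearMap.congr_fun h0 z

lemma exists_homogeneous_prime_over [IsNoetherianRing R] (𝒜 : ℕ → Submodule R A)
    [GradedAlgebra 𝒜] (hgen : ∀ n, 𝒜 n = 𝒜 1 ^ n) (hfg : (𝒜 1).FG) (𝔮 : Ideal A)
    [h𝔮p : 𝔮.IsPrime] (h𝔮 : 𝔮.IsHomogeneous 𝒜) (h1 : ¬ (𝒜 1 : Set A) ⊆ 𝔮) (𝔭 : Ideal R)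
    [𝔭.IsPrime] (hle : 𝔮.comap (algebraMap R A) ≤ 𝔭) :
    ∃ 𝔯 : Ideal A, 𝔯.IsPrime ∧ 𝔯.IsHomogeneous 𝒜 ∧ ¬ (𝒜 1 : Set A) ⊆ 𝔯 ∧ 𝔮 ≤ 𝔯 ∧
      𝔯.comap (algebraMap R A) = 𝔭 := by
  have hNoeth := isNoetherianRing_of_graded 𝒜 hgen hfg
  set W : Submonoid A := Algebra.algebraMapSubmonoid A 𝔭.primeCompl with hW
  set 𝔠 : Ideal A := 𝔮 ⊔ 𝔭.map (algebraMap R A) with h𝔠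
  let B := Localization W
  have key : ¬ (𝒜 1 : Set A) ⊆ ((𝔠.map (algebraMap A B)).comap (algebraMap A B)).radical := by
    intro hsub
    obtain ⟨N, hN⟩ := Ideal.exists_pow_le_of_le_radical_of_fg
      (Ideal.span_le.mpr hsub) (IsNoetherian.noetherian _)
    have hAN : ∀ a ∈ 𝒜 N, ∃ r, r ∉ 𝔭 ∧ r • a ∈ 𝔠 := by
      intro a ha
      have ha' : a ∈ (𝔠.map (algebraMap A B)).comap (algebraMap A B) := by
        apply hN
        rw [hgen] at ha
        have hpow : ∀ N, (𝒜 1) ^ N ≤ ((Ideal.span (𝒜 1 : Set A)) ^ N).restrictScalars R := by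
          intro N
          induction N with
          | zero => intro z _; simp
          | succ N ih =>
            rw [pow_succ, pow_succ, Submodule.mul_le]
            intro x hx y hy
            exact Ideal.mul_mem_mul (ih hx) (Ideal.subset_span hy)
        exact hpow N ha
      rw [Ideal.mem_comap, IsLocalization.algebraMap_mem_map_algebraMap_iff W] at ha'
      obtain ⟨_, ⟨r, hr, rfl⟩, hr'⟩ := ha'
      exact ⟨r, hr, by rwa [Algebra.smul_def]⟩
    have hfgN : (𝒜 N).FG := by rw [hgen]; exact hfg.pow N
    obtain ⟨r, hr, hrN⟩ : ∃ r, r ∉ 𝔭 ∧ ∀ a ∈ 𝒜 N, r • a ∈ 𝔠 := by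
      obtain ⟨Y, hY⟩ := hfgN
      have : ∀ a : A, ∃ r, r ∉ 𝔭 ∧ (a ∈ Y → r • a ∈ 𝔠) := by
        intro a
        by_cases ha : a ∈ Y
        · obtain ⟨r, hr, hra⟩ := hAN a (hY ▸ Submodule.subset_span ha)
          exact ⟨r, hr, fun _ => hra⟩
        · exact ⟨1, fun h => Ideal.IsPrime.ne_top ‹_› ((Ideal.eq_top_iff_one _).mpr h),
            fun h => absurd h ha⟩
      choose f hf hf' using this
      refine ⟨∏ a ∈ Y, f a, fun h => ?_, fun a ha => ?_⟩
      · obtain ⟨a, _, ha⟩ := (Ideal.IsPrime.prod_mem_iff).mp h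
        exact hf a ha
      · rw [← hY] at ha
        induction ha using Submodule.span_induction with
        | mem a ha =>
          obtain ⟨c, hc⟩ := Finset.dvd_prod_of_mem f ha
          rw [hc, mul_comm, mul_smul, Algebra.smul_def c]
          exact Ideal.mul_mem_left _ _ (hf' a ha)
        | zero => simp
        | add a b _ _ ha hb => rw [smul_add]; exact add_mem ha hb
        | smul c a _ ha =>
          rw [smul_comm, Algebra.smul_def c]; exact Ideal.mul_mem_left _ _ ha
    let g : A →ₗ[R] A ⧸ 𝔮 := (𝔮.mkQ).restrictScalars R
    have hfin : Module.Finite R ((𝒜 N).map g) := Module.Finite.iff_fg.mpr (hfgN.map _)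
    obtain ⟨s, hs, hs0⟩ := exists_smul_le_of_smul_le_sup 𝔭 (M := (𝒜 N).map g) r hr (by
      rintro ⟨_, a, ha, rfl⟩
      obtain ⟨y, hy, z, hz, hyz⟩ := Submodule.mem_sup.mp (hrN a ha)
      have h2 : r • a = (DirectSum.decompose 𝒜 y N : A) + (DirectSum.decompose 𝒜 z N : A) := by
        have : (DirectSum.decompose 𝒜 (r • a) N : A) = r • a :=
          DirectSum.decompose_of_mem_same 𝒜 (Submodule.smul_mem _ _ ha)
        rw [← this, ← hyz]; simp
      have h3 : (DirectSum.decompose 𝒜 y N : A) ∈ 𝔮 := h𝔮 N hy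
      have h4 := decompose_mem_smul_piece 𝒜 𝔭 hz N
      have h5 : r • g a ∈ 𝔭 • (𝒜 N).map g := by
        rw [← Submodule.map_smul'']
        refine ⟨_, h4, ?_⟩
        rw [← map_smul, h2, map_add]
        have : g (DirectSum.decompose 𝒜 y N : A) = 0 := by
          simpa [g] using (Ideal.Quotient.eq_zero_iff_mem.mpr h3)
        rw [this, zero_add]
      have h6 : ((𝔭 • (⊤ : Submodule R ((𝒜 N).map g))).map ((𝒜 N).map g).subtype) =
          𝔭 • (𝒜 N).map g := by
        rw [Submodule.map_smul'', Submodule.map_top, Submodule.range_subtype]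
      rw [← h6] at h5
      obtain ⟨w, hw, hw'⟩ := h5
      have h7 : r • (⟨g a, a, ha, rfl⟩ : (𝒜 N).map g) = w := Subtype.ext hw'.symm
      rw [h7]
      exact hw)
    apply h1
    intro y hy
    have hyN : y ^ N ∈ 𝒜 N := by rw [hgen]; exact Submodule.pow_mem_pow _ hy N
    have h2 := congrArg Subtype.val (hs0 ⟨g (y ^ N), y ^ N, hyN, rfl⟩)
    have h3 : s • y ^ N ∈ 𝔮 := by
      rw [← Ideal.Quotient.eq_zero_iff_mem]
      exact h2
    rw [Algebra.smul_def] at h3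
    rcases h𝔮p.mem_or_mem h3 with h | h
    · exact absurd (hle h) hs
    · exact h𝔮p.mem_of_pow_mem _ h
  obtain ⟨y, hy, hy'⟩ := Set.not_subset.mp key
  rw [← Ideal.comap_radical, SetLike.mem_coe, Ideal.mem_comap, Ideal.radical_eq_sInf,
    Submodule.mem_sInf] at hy'
  push Not at hy'
  obtain ⟨𝔯', ⟨h𝔯', hp⟩, hy'⟩ := hy'
  change Ideal B at 𝔯'
  have hp' : (𝔯'.comap (algebraMap A B)).IsPrime := hp.comap _
  have hmap : (𝔭.map (algebraMap R A)).IsHomogeneous 𝒜 := by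
    refine Ideal.homogeneous_span 𝒜 _ ?_
    rintro _ ⟨r, -, rfl⟩
    exact ⟨0, SetLike.algebraMap_mem_graded 𝒜 r⟩
  have hle𝔠 : 𝔠 ≤ (Ideal.homogeneousCore 𝒜 (𝔯'.comap (algebraMap A B))).toIdeal := by
    have h𝔠h : 𝔠.IsHomogeneous 𝒜 := h𝔮.sup hmap
    rw [← h𝔠h.toIdeal_homogeneousCore_eq_self]
    exact Ideal.homogeneousCore_mono 𝒜 (Ideal.map_le_iff_le_comap.mp h𝔯')
  refine ⟨(Ideal.homogeneousCore 𝒜 (𝔯'.comap (algebraMap A B))).toIdeal,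
    Ideal.IsPrime.homogeneousCore hp', HomogeneousIdeal.isHomogeneous _, fun h => ?_,
    le_sup_left.trans hle𝔠, le_antisymm (fun r hr => ?_) ?_⟩
  · exact hy' (Ideal.toIdeal_homogeneousCore_le 𝒜 _ (h hy))
  · by_contra hr'
    have h2 : algebraMap A B (algebraMap R A r) ∈ 𝔯' := Ideal.toIdeal_homogeneousCore_le 𝒜 _ hr
    exact hp.ne_top (Ideal.eq_top_of_isUnit_mem _ h2
      (IsLocalization.map_units B (⟨_, r, hr', rfl⟩ : W)))
  · exact Ideal.map_le_iff_le_comap.mp (le_sup_right.trans hle𝔠)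

end Lift

/-- The homogeneous primes of `A` not containing `𝒜 1` but containing `P`. -/
abbrev ProjAbove {R A : Type*} [CommRing R] [CommRing A] [Algebra R A] (𝒜 : ℕ → Submodule R A)
    [GradedAlgebra 𝒜] (P : Ideal A) : Type _ :=
  {Q : PrimeSpectrum A // Ideal.IsHomogeneous 𝒜 Q.asIdeal ∧ ¬ ((𝒜 1 : Set A) ⊆ ↑Q.asIdeal) ∧
    P ≤ Q.asIdeal}

section

variable {R A : Type*} [CommRing R] [IsNoetherianRing R] [CommRing A] [Algebra R A]

lemma exists_le_coheight_of_series (𝒜 : ℕ → Submodule R A)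
    [GradedAlgebra 𝒜] (hgen : ∀ n, 𝒜 n = 𝒜 1 ^ n) (hfg : (𝒜 1).FG) (P : Ideal A) (n : ℕ) :
    ∀ (s : LTSeries (PrimeSpectrum R)), s.length = n → ∀ 𝔮 : ProjAbove 𝒜 P,
      𝔮.1.asIdeal.comap (algebraMap R A) ≤ s.head.asIdeal →
      ∃ 𝔮' : ProjAbove 𝒜 P, 𝔮 ≤ 𝔮' ∧ 𝔮'.1.asIdeal.comap (algebraMap R A) = s.head.asIdeal ∧
        (n : ℕ∞) ≤ Order.coheight 𝔮' := by
  induction n with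
  | zero =>
    intro s _ 𝔮 hle
    obtain ⟨𝔯, hp, hh, h1, hq, hc⟩ := exists_homogeneous_prime_over 𝒜 hgen hfg 𝔮.1.asIdeal
      𝔮.2.1 𝔮.2.2.1 s.head.asIdeal hle
    exact ⟨⟨⟨𝔯, hp⟩, hh, h1, 𝔮.2.2.2.trans hq⟩, hq, hc, by simp⟩
  | succ n ih =>
    intro s hs 𝔮 hle
    have hs0 : s.length ≠ 0 := by omega
    obtain ⟨𝔯, hp, hh, h1, hq, hc⟩ := exists_homogeneous_prime_over 𝒜 hgen hfg 𝔮.1.asIdeal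
      𝔮.2.1 𝔮.2.2.1 s.head.asIdeal hle
    let 𝔮₁ : ProjAbove 𝒜 P := ⟨⟨𝔯, hp⟩, hh, h1, 𝔮.2.2.2.trans hq⟩
    have hlt : s.head.asIdeal < (s.tail hs0).head.asIdeal := by
      rw [PrimeSpectrum.asIdeal_lt_asIdeal, RelSeries.head_tail]
      exact s.strictMono (by
        rw [Fin.lt_def, Fin.val_one', Nat.mod_eq_of_lt (by omega)]
        simp)
    obtain ⟨𝔮₂, h12, hc2, hn⟩ := ih (s.tail hs0) (by simp [hs]) 𝔮₁ (hc.trans_le hlt.le)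
    refine ⟨𝔮₁, hq, hc, ?_⟩
    have hlt' : 𝔮₁ < 𝔮₂ := by
      refine lt_of_le_of_ne h12 ?_
      rintro rfl
      exact hlt.ne (hc.symm.trans hc2)
    rw [Nat.cast_succ]
    exact (add_le_add_left hn 1).trans (Order.coheight_add_one_le hlt')

lemma ringKrullDim_quotient_le_coheight (𝒜 : ℕ → Submodule R A)
    [GradedAlgebra 𝒜] (hgen : ∀ n, 𝒜 n = 𝒜 1 ^ n) (hfg : (𝒜 1).FG) (P : Ideal A)
    (𝔮 : ProjAbove 𝒜 P) (𝔭 : Ideal R) (h𝔭 : 𝔮.1.asIdeal.comap (algebraMap R A) ≤ 𝔭) :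
    ringKrullDim (R ⧸ 𝔭) ≤ Order.coheight 𝔮 := by
  rw [ringKrullDim_quotient]
  refine iSup_le fun s => ?_
  obtain ⟨𝔮', hle, -, h⟩ := exists_le_coheight_of_series 𝒜 hgen hfg P s.length
    (s.map Subtype.val (fun _ _ h => h)) rfl 𝔮 (h𝔭.trans s.head.2)
  exact_mod_cast h.trans (Order.coheight_anti hle)

end

lemma height_add_coheight_le_krullDim {α : Type*} [Preorder α] (a : α) :
    ((Order.height a + Order.coheight a : ℕ∞) : WithBot ℕ∞) ≤ Order.krullDim α := by
  have : Nonempty α := ⟨a⟩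
  rw [Order.krullDim_eq_iSup_height_add_coheight_of_nonempty]
  exact WithBot.coe_le_coe.mpr (le_iSup (fun a => Order.height a + Order.coheight a) a)

/-- A strictly increasing series, all of whose members satisfy `p`, as a series in a subtype. -/
def subtypeSeries {α : Type*} [Preorder α] {p : α → Prop} (s : LTSeries α) (h : ∀ a ∈ s, p a) :
    LTSeries {a // p a} where
  length := s.length
  toFun i := ⟨s i, h _ ⟨i, rfl⟩⟩
  step i := s.step i

section PolynomialChain
open MvPolynomial

variable {R k B σ : Type*} [CommRing R] [CommRing k] [CommRing B] [Algebra R k]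
  [Algebra k B] [Algebra R B] [IsScalarTower R k B] [DecidableEq σ]

/-- Evaluate the variables in `U` at the point `c`, and leave the other ones unchanged. -/
def partialEval (R : Type*) [CommRing R] [Algebra R B] (c : σ → B) (U : Finset σ) :
    MvPolynomial σ R →ₐ[R] MvPolynomial σ B :=
  aeval fun i => if i ∈ U then C (c i) else X i

lemma map_C_ker_le (c : σ → B) (U : Finset σ) :
    (RingHom.ker (algebraMap R B)).map (C : R →+* MvPolynomial σ R) ≤
      RingHom.ker (partialEval R c U) := by
  rw [Ideal.map_le_iff_le_comap]
  intro r hr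
  rw [RingHom.mem_ker] at hr
  rw [Ideal.mem_comap, RingHom.mem_ker, ← algebraMap_eq, AlgHom.commutes,
    MvPolynomial.algebraMap_apply, hr, map_zero]

lemma eval_partialEval (c : σ → B) (U : Finset σ) (a : σ) (f : MvPolynomial σ R) :
    aeval (fun i => if i = a then C (c a) else X i) (partialEval R c U f) =
      partialEval R c (insert a U) f := by
  have : ((aeval (fun i => if i = a then C (c a) else X i) :
      MvPolynomial σ B →ₐ[B] MvPolynomial σ B).restrictScalars R).comp (partialEval R c U) =
      partialEval R c (insert a U) := by
    ext1 i
    simp only [partialEval, AlgHom.comp_apply, aeval_X, AlgHom.restrictScalars_apply]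
    by_cases hi : i ∈ U
    · simp [hi]
    · by_cases hia : i = a
      · subst hia; simp [hi]
      · simp [hi, hia]
  exact DFunLike.congr_fun this f

lemma ker_partialEval_le (c : σ → B) (U : Finset σ) (a : σ) :
    RingHom.ker (partialEval R c U) ≤ RingHom.ker (partialEval R c (insert a U)) := by
  intro f hf
  rw [RingHom.mem_ker] at hf ⊢
  rw [← eval_partialEval, hf, map_zero]

lemma exists_lift_of_mem_adjoin (hs : Function.Surjective (algebraMap R k)) (c : σ → B)
    (T U : Finset σ) (hTU : T ⊆ U) (b : B) (hb : b ∈ Algebra.adjoin k (c '' (T : Set σ))) :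
    ∃ g : MvPolynomial σ R, partialEval R c U g = C b := by
  induction hb using Algebra.adjoin_induction with
  | mem b hb =>
    obtain ⟨i, hi, rfl⟩ := hb
    exact ⟨X i, by simp [partialEval, hTU hi]⟩
  | algebraMap r =>
    obtain ⟨r, rfl⟩ := hs r
    exact ⟨C r, by
      rw [← algebraMap_eq, AlgHom.commutes, MvPolynomial.algebraMap_apply,
        ← IsScalarTower.algebraMap_apply]⟩
  | add x y _ _ hx hy =>
    obtain ⟨f, hf⟩ := hx
    obtain ⟨g, hg⟩ := hy
    exact ⟨f + g, by rw [map_add, hf, hg, C_add]⟩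
  | mul x y _ _ hx hy =>
    obtain ⟨f, hf⟩ := hx
    obtain ⟨g, hg⟩ := hy
    exact ⟨f * g, by rw [map_mul, hf, hg, C_mul]⟩

lemma ker_partialEval_lt (hs : Function.Surjective (algebraMap R k)) (c : σ → B)
    (T U : Finset σ) (hTU : T ⊆ U) (a : σ) (ha : a ∉ U)
    (halg : IsAlgebraic (Algebra.adjoin k (c '' (T : Set σ))) (c a)) :
    RingHom.ker (partialEval R c U) < RingHom.ker (partialEval R c (insert a U)) := by
  refine lt_of_le_not_ge (ker_partialEval_le c U a) fun hle => ?_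
  obtain ⟨p, hp0, hp⟩ := halg
  choose g hg using fun j => exists_lift_of_mem_adjoin (R := R) hs c T U hTU
    (p.coeff j).1 (p.coeff j).2
  set f : MvPolynomial σ R := ∑ j ∈ Finset.range (p.natDegree + 1), g j * X a ^ j with hf
  have hU : partialEval R c U f =
      ∑ j ∈ Finset.range (p.natDegree + 1), C (p.coeff j : B) * X a ^ j := by
    rw [hf, map_sum]
    refine Finset.sum_congr rfl fun j _ => ?_
    rw [map_mul, hg, map_pow]
    simp [partialEval, ha]
  have hUa : partialEval R c (insert a U) f = 0 := by
    rw [← eval_partialEval, hU]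
    have : (Polynomial.aeval (c a)) p = ∑ j ∈ Finset.range (p.natDegree + 1),
        (p.coeff j : B) * c a ^ j := by
      rw [Polynomial.aeval_eq_sum_range]
      rfl
    rw [hp] at this
    simp only [map_sum, map_mul, map_pow, aeval_X, if_pos]
    rw [← C_0, this, map_sum]
    refine Finset.sum_congr rfl fun j _ => ?_
    rw [map_mul, map_pow, ← algebraMap_eq, AlgHom.commutes]
  have hU0 := hle hUa
  rw [RingHom.mem_ker, hU] at hU0
  apply hp0
  ext j
  by_cases hj : j ≤ p.natDegree
  · have := congrArg (coeff (Finsupp.single a j)) hU0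
    rw [coeff_sum, Finset.sum_eq_single j] at this
    · rw [X_pow_eq_monomial, coeff_C_mul, coeff_monomial, if_pos rfl] at this
      simpa using this
    · intro l _ hl
      rw [X_pow_eq_monomial, coeff_C_mul, coeff_monomial, if_neg, mul_zero]
      intro h
      exact hl (Finsupp.single_injective a h)
    · intro h
      exact absurd (Finset.mem_range.mpr (by omega)) h
  · rw [Polynomial.coeff_eq_zero_of_natDegree_lt (by omega)]
    simp

variable [IsDomain B]

/-- The kernel of `partialEval` as a point of the closed set defined by `Ker (R → B)`. -/
def partialKer (R : Type*) [CommRing R] [Algebra R B] (c : σ → B) (U : Finset σ) :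
    PrimeSpectrum.zeroLocus
      (((RingHom.ker (algebraMap R B)).map (C : R →+* MvPolynomial σ R) : Ideal _) :
        Set (MvPolynomial σ R)) :=
  ⟨⟨RingHom.ker (partialEval R c U), RingHom.ker_isPrime _⟩, map_C_ker_le c U⟩

lemma card_le_height_partialKer (hs : Function.Surjective (algebraMap R k)) (c : σ → B)
    (T : Finset σ)
    (halg : ∀ a ∉ T, IsAlgebraic (Algebra.adjoin k (c '' (T : Set σ))) (c a))
    (V : Finset σ) (hV : Disjoint V T) :
    (V.card : ℕ∞) ≤ Order.height (partialKer R c (V ∪ T)) := by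
  induction V using Finset.induction_on with
  | empty => simp
  | insert a V ha ih =>
    rw [Finset.disjoint_insert_left] at hV
    rw [Finset.card_insert_of_notMem ha, Finset.insert_union, Nat.cast_succ]
    refine (add_le_add_left (ih hV.2) 1).trans (Order.height_add_one_le ?_)
    exact ker_partialEval_lt hs c T (V ∪ T) Finset.subset_union_right a
      (by simp [ha, hV.1]) (halg a hV.1)

lemma series_length_add_one_le [Fintype σ] [IsNoetherianRing R]
    (hs : Function.Surjective (algebraMap R k)) (c : σ → B) (T : Finset σ)
    (halg : ∀ a ∉ T, IsAlgebraic (Algebra.adjoin k (c '' (T : Set σ))) (c a))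
    (d : ℕ) (hd : ringKrullDim (R ⧸ RingHom.ker (algebraMap R B)) ≤ d)
    (s : LTSeries (PrimeSpectrum (MvPolynomial σ R)))
    (hhead : RingHom.ker (aeval c : MvPolynomial σ R →ₐ[R] B) ≤ s.head.asIdeal)
    (hC : ∀ f ∈ s.last.asIdeal, C (constantCoeff f) ∈ s.last.asIdeal)
    (hX : ∃ i, (X i : MvPolynomial σ R) ∉ s.last.asIdeal) : s.length + 1 ≤ d + T.card := by
  set 𝔭 := RingHom.ker (algebraMap R B) with h𝔭
  let Q : PrimeSpectrum (MvPolynomial σ R) :=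
    ⟨(s.last.asIdeal.comap C).comap constantCoeff, inferInstance⟩
  have hQ : s.last < Q := by
    refine lt_of_le_of_ne (fun f hf => hC f hf) fun h => ?_
    obtain ⟨i, hi⟩ := hX
    apply hi
    rw [h]
    change C (constantCoeff (X i)) ∈ s.last.asIdeal
    simp
  have hker : RingHom.ker (partialEval R c Finset.univ) =
      RingHom.ker (aeval c : MvPolynomial σ R →ₐ[R] B) := by
    have : partialEval R c Finset.univ =
        (IsScalarTower.toAlgHom R B (MvPolynomial σ B)).comp (aeval c) := by
      ext1 i; simp [partialEval]
    ext f
    rw [RingHom.mem_ker, RingHom.mem_ker, this, AlgHom.comp_apply, IsScalarTower.coe_toAlgHom',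
      algebraMap_eq, C_eq_zero]
  let s' := s.snoc Q hQ
  have hmem : ∀ p ∈ s', (partialKer R c Finset.univ).1 ≤ p := by
    intro p hp
    have h1 : s.head ≤ p := by
      obtain ⟨m, rfl⟩ := hp
      have h2 : s'.head = s.head := RelSeries.head_snoc _ _ _
      rw [← h2]
      exact LTSeries.head_le s' m
    exact le_trans (by change RingHom.ker _ ≤ _; rw [hker]; exact hhead) h1
  let t := subtypeSeries (p := (· ∈ PrimeSpectrum.zeroLocus
      ((𝔭.map (C : R →+* MvPolynomial σ R) : Ideal _) : Set (MvPolynomial σ R)))) s'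
    fun p hp => (map_C_ker_le c Finset.univ).trans (hmem p hp)
  have hco : ((s.length + 1 : ℕ) : ℕ∞) ≤ Order.coheight (partialKer R c Finset.univ) :=
    Order.length_le_coheight (p := t) (hmem _ s'.head_mem)
  have hht := card_le_height_partialKer hs c T halg (Finset.univ \ T) Finset.sdiff_disjoint
  rw [Finset.sdiff_union_of_subset (Finset.subset_univ T)] at hht
  have hdim : Order.krullDim (PrimeSpectrum.zeroLocus
      ((𝔭.map (C : R →+* MvPolynomial σ R) : Ideal _) : Set (MvPolynomial σ R))) ≤
      ((d + Fintype.card σ : ℕ) : WithBot ℕ∞) := by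
    rw [← ringKrullDim_quotient, ← ringKrullDim_eq_of_ringEquiv
      (MvPolynomial.quotientEquivQuotientMvPolynomial 𝔭).toRingEquiv,
      MvPolynomial.ringKrullDim_of_isNoetherianRing, Nat.card_eq_fintype_card, Nat.cast_add]
    exact add_le_add_left hd _
  have hfin := ((WithBot.coe_le_coe.mpr (add_le_add hht hco)).trans
    (height_add_coheight_le_krullDim _)).trans hdim
  have hcard := Finset.card_sdiff_add_card_eq_card (Finset.subset_univ T)
  rw [Finset.card_univ] at hcard
  have : (Finset.univ \ T).card + (s.length + 1) ≤ d + Fintype.card σ := by exact_mod_cast hfin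
  omega

end PolynomialChain

section GenericFibre
open TensorProduct

variable {R A : Type*} [CommRing R] [CommRing A] [Algebra R A]

lemma baseLength_ne_top_of_pow_smul_le {S M : Type*} [CommRing S] [IsNoetherianRing S]
    [IsLocalRing S] [Algebra R S] [AddCommGroup M] [Module R M] (𝔞 : Ideal R)
    (h𝔞 : 𝔞.map (algebraMap R S) = IsLocalRing.maximalIdeal S) (n : ℕ) {P Q : Submodule R M}
    (hQ : Q.FG) (h : 𝔞 ^ n • Q ≤ P) : baseLength S P Q ≠ ⊤ := by
  have : Module.Finite R Q := Module.Finite.iff_fg.mpr hQ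
  refine length_ne_top_of_pow_smul_eq_bot n fun a ha z => ?_
  rw [← h𝔞, ← Ideal.map_pow] at ha
  induction z using TensorProduct.induction_on with
  | zero => simp
  | add x y hx hy => rw [smul_add, hx, hy, add_zero]
  | tmul b y =>
    induction ha using Submodule.span_induction with
    | mem a ha =>
      obtain ⟨r, hr, rfl⟩ := ha
      rw [algebraMap_smul, TensorProduct.smul_tmul', TensorProduct.smul_tmul]
      obtain ⟨⟨y, hy⟩, rfl⟩ := Submodule.Quotient.mk_surjective _ y
      rw [← Submodule.Quotient.mk_smul, (Submodule.Quotient.mk_eq_zero _).mpr, tmul_zero]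
      exact h (Submodule.smul_mem_smul hr hy)
    | zero => simp
    | add a a' _ _ h h' => rw [add_smul, h, h', add_zero]
    | smul a a' _ h => rw [smul_assoc, h, smul_zero]

lemma card_le_baseLength_pi (𝔭 : Ideal R) [𝔭.IsPrime] (ι : Type*) [Fintype ι] [DecidableEq ι] :
    (Fintype.card ι : ℕ∞) ≤ baseLength (Localization.AtPrime 𝔭)
      (Submodule.pi Set.univ (fun _ : ι => (𝔭 : Submodule R R))) ⊤ := by
  let S := Localization.AtPrime 𝔭
  let κ := IsLocalRing.ResidueField S
  set P1 : Submodule R (ι → R) := Submodule.pi Set.univ (fun _ : ι => (𝔭 : Submodule R R))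
  let l0 : (ι → R) →ₗ[R] (ι → κ) := LinearMap.pi fun i =>
    (Algebra.linearMap R κ).comp (LinearMap.proj i)
  have hl0 : ∀ z ∈ P1, l0 z = 0 := by
    intro z hz
    funext i
    have hzi : z i ∈ 𝔭 := hz i (Set.mem_univ i)
    change algebraMap R κ (z i) = 0
    rw [IsScalarTower.algebraMap_apply R S κ]
    change IsLocalRing.residue S (algebraMap R S (z i)) = 0
    rw [IsLocalRing.residue_eq_zero_iff]
    exact (IsLocalization.AtPrime.to_map_mem_maximal_iff S 𝔭 (z i)).mpr hzi
  let l : (↥(⊤ : Submodule R (ι → R)) ⧸ P1.comap (⊤ : Submodule R (ι → R)).subtype) →ₗ[R] (ι → κ) :=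
    Submodule.liftQ _ (l0.comp (Submodule.subtype ⊤)) fun z hz => hl0 _ hz
  let L : S ⊗[R] (↥(⊤ : Submodule R (ι → R)) ⧸ P1.comap (⊤ : Submodule R (ι → R)).subtype) →ₗ[S]
    (ι → κ) := LinearMap.liftBaseChange S l
  have hL : Function.Surjective L := by
    rw [← LinearMap.range_eq_top, eq_top_iff]
    intro v _
    rw [← Finset.univ_sum_single v]
    refine Submodule.sum_mem _ fun i _ => ?_
    obtain ⟨a, ha⟩ := IsLocalRing.residue_surjective (v i)
    refine ⟨a ⊗ₜ Submodule.Quotient.mk ⟨Pi.single i 1, trivial⟩, ?_⟩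
    rw [LinearMap.liftBaseChange_tmul, ← ha]
    funext j
    change a • algebraMap R κ ((Pi.single i 1 : ι → R) j) = _
    by_cases hij : j = i
    · subst hij
      simp only [Pi.single_eq_same, map_one, Algebra.smul_def, mul_one]
      rfl
    · simp [hij]
  refine le_trans ?_ (Module.length_le_of_surjective L hL)
  rw [Module.length_pi_of_fintype]
  have h1 : (1 : ℕ∞) ≤ Module.length S κ := Order.one_le_iff_ne_zero.mpr (Module.length_pos).ne'
  calc (Fintype.card ι : ℕ∞) = ∑ _i : ι, (1 : ℕ∞) := by simp
    _ ≤ _ := Finset.sum_le_sum fun _ _ => h1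

lemma pow_le_baseLength_piece (𝒜 : ℕ → Submodule R A) [GradedAlgebra 𝒜] (P : Ideal A) [P.IsPrime]
    (𝔭 : Ideal R) [𝔭.IsPrime] [P.LiesOver 𝔭] (s d : ℕ) (e : Fin (d + 1) → A)
    (he : ∀ i, e i ∈ 𝒜 s)
    (hind : AlgebraicIndependent (R ⧸ 𝔭) (fun i => Ideal.Quotient.mk P (e i))) (u : ℕ) :
    (((u + 1) ^ d : ℕ) : ℕ∞) ≤ baseLength (Localization.AtPrime 𝔭)
      (P.restrictScalars R ⊓ 𝒜 (d * u * s)) (𝒜 (d * u * s)) := by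
  let ι := Fin d → Fin (u + 1)
  let β : ι → (Fin (d + 1) →₀ ℕ) := fun α =>
    Finsupp.equivFunOnFinite.symm (Fin.cons (d * u - ∑ i, (α i : ℕ)) fun i => (α i : ℕ))
  have hβ : Function.Injective β := by
    intro α α' h
    funext i
    have := DFunLike.congr_fun h i.succ
    simpa [β, Fin.val_inj] using this
  have hdeg : ∀ α, (∑ i, β α i) = d * u := by
    intro α
    have h1 : ∑ i, (α i : ℕ) ≤ d * u :=
      (Finset.sum_le_card_nsmul Finset.univ _ u fun i _ => by omega).trans (by simp)
    rw [Fin.sum_univ_succ]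
    simp only [β, Finsupp.equivFunOnFinite_symm_apply_apply, Fin.cons_zero, Fin.cons_succ]
    omega
  let f : (ι → R) →ₗ[R] A := Fintype.linearCombination R fun α => ∏ i, e i ^ β α i
  have hf : ∀ z, f z = ∑ α, z α • ∏ i, e i ^ β α i := fun z => Fintype.linearCombination_apply _ _ _
  have hfmem : ∀ z, f z ∈ 𝒜 (d * u * s) := by
    intro z
    rw [hf]
    refine Submodule.sum_mem _ fun α _ => Submodule.smul_mem _ _ ?_
    have := SetLike.prod_mem_graded 𝒜 (fun i => β α i • s) (fun i => e i ^ β α i)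
      (F := Finset.univ) fun i _ => SetLike.pow_mem_graded _ (he i)
    rw [← Finset.sum_smul, hdeg] at this
    exact this
  have hinj : ∀ z, f z ∈ P → ∀ α, z α ∈ 𝔭 := by
    intro z hz
    let g : MvPolynomial (Fin (d + 1)) (R ⧸ 𝔭) :=
      ∑ α, MvPolynomial.monomial (β α) (Ideal.Quotient.mk 𝔭 (z α))
    have hg : MvPolynomial.aeval (fun i => Ideal.Quotient.mk P (e i)) g = 0 := by
      rw [← Ideal.Quotient.eq_zero_iff_mem, hf, map_sum] at hz
      rw [map_sum, ← hz]
      refine Finset.sum_congr rfl fun α _ => ?_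
      rw [MvPolynomial.aeval_monomial, Finsupp.prod_fintype _ _ (by simp), Algebra.smul_def,
        map_mul, map_prod]
      simp only [map_pow]
      rfl
    have hg0 : g = 0 := hind (by rw [hg, map_zero])
    intro α
    have := congrArg (MvPolynomial.coeff (β α)) hg0
    rw [MvPolynomial.coeff_sum, Finset.sum_eq_single α] at this
    · rw [MvPolynomial.coeff_monomial, if_pos rfl] at this
      exact Ideal.Quotient.eq_zero_iff_mem.mp this
    · intro α' _ hα'
      rw [MvPolynomial.coeff_monomial, if_neg fun h => hα' (hβ h)]
    · intro h
      exact absurd (Finset.mem_univ _) h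
  have hle := baseLength_le_of_inj (Localization.AtPrime 𝔭) f
    (P := Submodule.pi Set.univ (fun _ : ι => (𝔭 : Submodule R R))) (T := ⊤)
    (P' := P.restrictScalars R ⊓ 𝒜 (d * u * s)) (T' := 𝒜 (d * u * s))
    (fun z _ => hfmem z)
    (by
      intro z hz
      refine ⟨?_, hfmem z⟩
      change f z ∈ P
      rw [hf]
      refine Ideal.sum_mem _ fun α _ => ?_
      rw [Algebra.smul_def]
      refine Ideal.mul_mem_right _ _ ?_
      have hzα : z α ∈ 𝔭 := hz α (Set.mem_univ α)
      rwa [Ideal.mem_of_liesOver P 𝔭] at hzα)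
    (fun z _ hz α _ => hinj z hz.1 α)
  refine le_trans ?_ hle
  refine le_trans ?_ (card_le_baseLength_pi 𝔭 ι)
  simp [ι]

lemma exists_le_height_generic [IsNoetherianRing R] (𝒜 : ℕ → Submodule R A) [GradedAlgebra 𝒜]
    (hgen : ∀ n, 𝒜 n = 𝒜 1 ^ n) (hfg : (𝒜 1).FG) (P : Ideal A) [hP : P.IsPrime]
    (hPh : P.IsHomogeneous 𝒜) (hP1 : ¬ (𝒜 1 : Set A) ⊆ P)
    (𝔭 : Ideal R) [𝔭.IsPrime] [P.LiesOver 𝔭] (s d : ℕ) (hs : 0 < s) (e : Fin (d + 1) → A)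
    (he : ∀ i, e i ∈ 𝒜 s)
    (hind : AlgebraicIndependent (R ⧸ 𝔭) (fun i => Ideal.Quotient.mk P (e i))) :
    ∃ 𝔮 : ProjAbove 𝒜 P, 𝔮.1.asIdeal.comap (algebraMap R A) = 𝔭 ∧
      (d : ℕ∞) ≤ Order.height 𝔮 := by
  have hNoeth := isNoetherianRing_of_graded 𝒜 hgen hfg
  have hP𝔭 : P.comap (algebraMap R A) = 𝔭 := (Ideal.LiesOver.over (P := P) (p := 𝔭)).symm
  rcases Nat.eq_zero_or_pos d with rfl | hd0
  · exact ⟨⟨⟨P, hP⟩, hPh, hP1, le_rfl⟩, hP𝔭, by simp⟩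
  by_contra hcon
  push Not at hcon
  let S := Localization.AtPrime 𝔭
  let 𝒢 : Set (PrimeSpectrum A) := {p | p.asIdeal.IsHomogeneous 𝒜 ∧
    ¬ (𝒜 1 : Set A) ⊆ p.asIdeal ∧ p.asIdeal.comap (algebraMap R A) = 𝔭}
  have hbound := growth_bound 𝒜 (lam := baseLength S) (baseLength_isSubLength S) (E := ⊥) bot_le 𝒢
    (fun p hp => hp.2.1) P ?_ ?_ P hPh le_rfl d ?_
  · obtain ⟨w, hw⟩ := hbound
    obtain ⟨d', rfl⟩ : ∃ d', d = d' + 1 := ⟨d - 1, by omega⟩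
    obtain ⟨K, hK⟩ := hw w le_rfl
    obtain ⟨t₀, ht₀⟩ := Filter.eventually_atTop.mp hK
    set u := t₀ + w + 1 + K * ((d' + 1) * s) ^ d' with hu
    have htu : u ≤ (d' + 1) * u * s := by
      calc u = 1 * u * 1 := by ring
        _ ≤ _ := by gcongr <;> omega
    have h1 := ht₀ ((d' + 1) * u * s) (by omega)
    have h2 := pow_le_baseLength_piece 𝒜 P 𝔭 s (d' + 1) e he hind u
    have h3 : growth 𝒜 (baseLength S) ⊥ P w ((d' + 1) * u * s) =
        baseLength S (P.restrictScalars R ⊓ 𝒜 ((d' + 1) * u * s)) (𝒜 ((d' + 1) * u * s)) := by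
      rw [growth, ← Submodule.zero_eq_bot, zero_pow (by omega), zero_mul, Submodule.zero_eq_bot,
        sup_bot_eq]
    rw [h3] at h1
    have h4 : (u + 1) ^ (d' + 1) ≤ K * ((d' + 1) * u * s) ^ d' := by exact_mod_cast h2.trans h1
    have h5 : K * ((d' + 1) * u * s) ^ d' ≤ (K * ((d' + 1) * s) ^ d') * (u + 1) ^ d' := by
      calc K * ((d' + 1) * u * s) ^ d' = (K * ((d' + 1) * s) ^ d') * u ^ d' := by
            rw [mul_right_comm, mul_pow _ u, mul_assoc]
        _ ≤ _ := by gcongr; omega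
    rw [pow_succ'] at h4
    have h6 := Nat.le_of_mul_le_mul_right (h4.trans h5) (by positivity)
    omega
  · intro 𝔞 h𝔞 w t _
    refine ne_top_of_le_ne_top ?_ (baseLength_anti S (𝒜 t)
      (show P.restrictScalars R ⊓ 𝒜 t ≤ _ from
        le_sup_of_le_left (inf_le_inf_right _ h𝔞)))
    have hfgt : (𝒜 t).FG := by rw [hgen]; exact hfg.pow t
    have hNS : IsNoetherianRing S := IsLocalization.isNoetherianRing 𝔭.primeCompl S inferInstance
    refine baseLength_ne_top_of_pow_smul_le 𝔭 Localization.AtPrime.map_eq_maximalIdeal 1 hfgt ?_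
    rw [pow_one, Submodule.smul_le]
    intro r hr y hy
    refine ⟨?_, Submodule.smul_mem _ _ hy⟩
    change r • y ∈ P
    rw [Algebra.smul_def]
    exact Ideal.mul_mem_right _ _ ((Ideal.mem_of_liesOver P 𝔭 r).mp hr)
  · intro p hph hPp hp
    refine ⟨0, fun w _ => ?_⟩
    by_cases h1 : (𝒜 1 : Set A) ⊆ p.asIdeal
    · filter_upwards [Filter.eventually_ge_atTop 1] with t ht
      refine baseLength_eq_zero_of_le S (le_sup_of_le_left (le_inf ?_ le_rfl))
      obtain ⟨t', rfl⟩ : ∃ t', t = t' + 1 := ⟨t - 1, by omega⟩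
      rw [hgen, pow_succ, Submodule.mul_le]
      intro a _ b hb
      exact Ideal.mul_mem_left _ _ (h1 hb)
    · have hne : ¬ p.asIdeal.comap (algebraMap R A) = 𝔭 := fun h => hp ⟨hph, h1, h⟩
      have hle : 𝔭 ≤ p.asIdeal.comap (algebraMap R A) := by
        rw [← hP𝔭]; exact Ideal.comap_mono hPp
      obtain ⟨r, hr, hr'⟩ := Set.not_subset.mp fun h => hne (le_antisymm h hle)
      refine Filter.Eventually.of_forall fun t => ?_
      refine baseLength_eq_zero_of_smul_mem S (r := r)
        (IsLocalization.map_units S (⟨r, hr'⟩ : 𝔭.primeCompl)) fun z hz => ?_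
      refine Submodule.mem_sup_left ⟨?_, Submodule.smul_mem _ _ hz⟩
      change r • z ∈ p.asIdeal
      rw [Algebra.smul_def]
      exact Ideal.mul_mem_right _ _ hr
  · intro c hc
    let t : LTSeries (ProjAbove 𝒜 P) := subtypeSeries c fun p hp =>
      ⟨(hc p hp).1.1, (hc p hp).1.2.1, (hc p hp).2⟩
    have h1 := hcon t.last (hc c.last c.last_mem).1.2.2
    have h2 : (t.length : ℕ∞) ≤ Order.height t.last := Order.length_le_height le_rfl
    exact_mod_cast h2.trans_lt h1

end GenericFibre

section ChainBound

variable {R A : Type*} [CommRing R] [IsNoetherianRing R] [IsLocalRing R] [CommRing A] [Algebra R A]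

lemma exists_algebraicIndepOn_finset {k B σ : Type*} [CommRing k] [CommRing B] [Algebra k B]
    [Fintype σ] [DecidableEq σ] (hinj : Function.Injective (algebraMap k B)) (c : σ → B) :
    ∃ T : Finset σ, AlgebraicIndepOn k c (T : Set σ) ∧
      ∀ a ∉ T, IsAlgebraic (Algebra.adjoin k (c '' (T : Set σ))) (c a) := by
  obtain ⟨T, hT⟩ := (Set.toFinite {T : Finset σ | AlgebraicIndepOn k c (T : Set σ)}).exists_maximal
    ⟨∅, by
      have : IsEmpty ((∅ : Finset σ) : Set σ) := by simp
      exact algebraicIndependent_empty_type_iff.mpr hinj⟩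
  refine ⟨T, hT.prop, fun a ha => ?_⟩
  by_contra htr
  have h1 : AlgebraicIndepOn k c (insert a (T : Set σ)) :=
    (AlgebraicIndepOn.insert_iff (by simpa using ha)).mpr ⟨hT.prop, htr⟩
  rw [← Finset.coe_insert] at h1
  exact ha (hT.le_of_ge h1 (Finset.subset_insert a T) (Finset.mem_insert_self a T))

lemma series_length_le (𝒜 : ℕ → Submodule R A) [GradedAlgebra 𝒜]
    (hgen : ∀ n, 𝒜 n = 𝒜 1 ^ n) (hfg : (𝒜 1).FG) (P : Ideal A) [hP : P.IsPrime]
    (hPh : P.IsHomogeneous 𝒜) (hP1 : ¬ (𝒜 1 : Set A) ⊆ P) (D : ℕ)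
    (hD : Order.krullDim (ProjAbove 𝒜 P) ≤ D) {σ : Type*} [Fintype σ] [DecidableEq σ]
    (s : ℕ) (hs : 0 < s) (e : σ → A) (he : ∀ i, e i ∈ 𝒜 s)
    (c : LTSeries (PrimeSpectrum (MvPolynomial σ R)))
    (hhead : P.comap (MvPolynomial.aeval e : MvPolynomial σ R →ₐ[R] A) ≤ c.head.asIdeal)
    (hC : ∀ f ∈ c.last.asIdeal,
      MvPolynomial.C (MvPolynomial.constantCoeff f) ∈ c.last.asIdeal)
    (hX : ∃ i, (MvPolynomial.X i : MvPolynomial σ R) ∉ c.last.asIdeal) : c.length ≤ D := by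
  set 𝔭 : Ideal R := P.under R with h𝔭
  have hker : RingHom.ker (algebraMap R (A ⧸ P)) = 𝔭 := by
    ext r
    rw [RingHom.mem_ker, IsScalarTower.algebraMap_apply R A (A ⧸ P), Ideal.Quotient.algebraMap_eq,
      Ideal.Quotient.eq_zero_iff_mem]
    rfl
  obtain ⟨T, hT, halg⟩ := exists_algebraicIndepOn_finset (k := R ⧸ 𝔭) (B := A ⧸ P)
    (FaithfulSMul.algebraMap_injective _ _) (fun i => Ideal.Quotient.mk P (e i))
  obtain ⟨d, hd⟩ : ∃ d : ℕ, ringKrullDim (R ⧸ 𝔭) = d := by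
    have : 𝔭.IsPrime := by rw [h𝔭]; infer_instance
    have : IsLocalRing (R ⧸ 𝔭) :=
      IsLocalRing.of_surjective' (Ideal.Quotient.mk 𝔭) Ideal.Quotient.mk_surjective
    obtain ⟨a, ha⟩ := WithBot.ne_bot_iff_exists.mp (ringKrullDim_ne_bot (R := R ⧸ 𝔭))
    obtain ⟨d, hd⟩ := ENat.ne_top_iff_exists.mp (fun h : a = ⊤ =>
      ringKrullDim_ne_top (R := R ⧸ 𝔭) (by rw [← ha, h]; rfl))
    exact ⟨d, by rw [← ha, ← hd]; rfl⟩
  have hup := series_length_add_one_le (R := R) (k := R ⧸ 𝔭) (B := A ⧸ P)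
    Ideal.Quotient.mk_surjective (fun i => Ideal.Quotient.mk P (e i)) T halg d
    (by rw [hker, hd]) c (by
      intro f hf
      apply hhead
      rw [Ideal.mem_comap, ← Ideal.Quotient.eq_zero_iff_mem]
      rw [RingHom.mem_ker] at hf
      rw [← hf]
      have : (MvPolynomial.aeval fun i => Ideal.Quotient.mk P (e i)) =
        (Ideal.Quotient.mkₐ R P).comp (MvPolynomial.aeval e) := by
        ext1 i; simp
      rw [this]; rfl) hC hX
  have hlow : ∀ (𝔮 : ProjAbove 𝒜 P) (d' : ℕ), 𝔮.1.asIdeal.comap (algebraMap R A) = 𝔭 →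
      (d' : ℕ∞) ≤ Order.height 𝔮 → d' + d ≤ D := by
    intro 𝔮 d' h𝔮 hd'
    have h1 := ringKrullDim_quotient_le_coheight 𝒜 hgen hfg P 𝔮 𝔭 h𝔮.le
    rw [hd] at h1
    have h2 : (d : ℕ∞) ≤ Order.coheight 𝔮 := by exact_mod_cast h1
    have h3 := ((WithBot.coe_le_coe.mpr (add_le_add hd' h2)).trans
      (height_add_coheight_le_krullDim _)).trans hD
    exact_mod_cast h3
  rcases hcard : T.card with _ | d'
  · have := hlow ⟨⟨P, hP⟩, hPh, hP1, le_rfl⟩ 0 rfl (by simp)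
    omega
  · let f : Fin (d' + 1) ≃ T := (T.equivFinOfCardEq hcard).symm
    obtain ⟨𝔮, h𝔮, hd'⟩ := exists_le_height_generic 𝒜 hgen hfg P hPh hP1 𝔭 s d' hs
      (fun i => e (f i)) (fun i => he _) (AlgebraicIndependent.comp hT f f.injective)
    have := hlow 𝔮 d' h𝔮 hd'
    omega

end ChainBound

section PolynomialGrowth

lemma ideal_mul_smul_mul_le {R A : Type*} [CommRing R] [CommRing A] [Algebra R A]
    {𝔞 𝔟 : Ideal R} {X Y Z W : Submodule R A} (hX : 𝔞 • X ≤ Z) (hY : 𝔟 • Y ≤ W) :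
    (𝔞 * 𝔟) • (X * Y) ≤ Z * W := by
  rw [mul_smul, Submodule.smul_le]
  intro a ha z hz
  refine Submodule.smul_induction_on hz ?_ ?_
  · intro b hb y hy
    refine Submodule.mul_induction_on hy ?_ ?_
    · intro u hu v hv
      rw [show a • b • (u * v) = (a • u) * (b • v) by rw [smul_mul_smul_comm, mul_smul]]
      exact Submodule.mul_mem_mul (hX (Submodule.smul_mem_smul ha hu))
        (hY (Submodule.smul_mem_smul hb hv))
    · intro u v hu hv
      rw [smul_add, smul_add]
      exact add_mem hu hv
  · intro u v hu hv
    rw [smul_add]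
    exact add_mem hu hv

lemma ideal_pow_smul_pow_le {R A : Type*} [CommRing R] [CommRing A] [Algebra R A]
    {𝔞 : Ideal R} {X Z : Submodule R A} (hX : 𝔞 • X ≤ Z) (n : ℕ) :
    𝔞 ^ n • X ^ n ≤ Z ^ n := by
  induction n with
  | zero => simp
  | succ n ih =>
    rw [pow_succ, pow_succ, pow_succ]
    exact ideal_mul_smul_mul_le ih hX

lemma ideal_pow_smul_mul_le {R A : Type*} [CommRing R] [CommRing A] [Algebra R A]
    {𝔞 : Ideal R} {X Y Z : Submodule R A} (hX : 𝔞 • X ≤ Z) :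
    𝔞 • (X * Y) ≤ Z * Y := by
  have h := ideal_mul_smul_mul_le (𝔟 := ⊤) hX (Submodule.smul_le_right : _ ≤ Y)
  rwa [Ideal.mul_top] at h

variable {R A : Type*} [CommRing R] [CommRing A] [Algebra R A]

lemma map_aeval_homogeneousSubmodule {σ : Type*} (e : σ → A) (t : ℕ) :
    (MvPolynomial.homogeneousSubmodule σ R t).map
      (MvPolynomial.aeval e : MvPolynomial σ R →ₐ[R] A).toLinearMap =
      Submodule.span R (Set.range e) ^ t := by
  rw [← MvPolynomial.homogeneousSubmodule_one_pow, Submodule.map_pow,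
    MvPolynomial.homogeneousSubmodule_one_eq_span_X, Submodule.map_span, ← Set.range_comp]
  congr 3
  ext i
  simp

attribute [local instance] MvPolynomial.gradedAlgebra

lemma decompose_eq_homogeneousComponent {σ : Type*} (f : MvPolynomial σ R) (t : ℕ) :
    (DirectSum.decompose (MvPolynomial.homogeneousSubmodule σ R) f t : MvPolynomial σ R) =
      MvPolynomial.homogeneousComponent t f :=
  MvPolynomial.decomposition.decompose'_apply f t

lemma isHomogeneous_comap_aeval (𝒜 : ℕ → Submodule R A) [GradedAlgebra 𝒜]
    (hgen : ∀ n, 𝒜 n = 𝒜 1 ^ n) {σ : Type*} (s : ℕ) (hs : 0 < s) (e : σ → A)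
    (he : ∀ i, e i ∈ 𝒜 s) {𝔠 : Ideal A} (h𝔠 : 𝔠.IsHomogeneous 𝒜) :
    (𝔠.comap (MvPolynomial.aeval e : MvPolynomial σ R →ₐ[R] A)).IsHomogeneous
      (MvPolynomial.homogeneousSubmodule σ R) := by
  classical
  intro t f hf
  rw [decompose_eq_homogeneousComponent]
  have hmem (u : ℕ) : MvPolynomial.aeval e (MvPolynomial.homogeneousComponent u f) ∈ 𝒜 (s * u) := by
    refine pow_le_piece 𝒜 hgen (E := Submodule.span R (Set.range e)) ?_ u ?_
    · rw [Submodule.span_le]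
      rintro _ ⟨i, rfl⟩
      exact he i
    · rw [← map_aeval_homogeneousSubmodule]
      exact ⟨_, MvPolynomial.homogeneousComponent_mem u f, rfl⟩
  by_cases ht : t ∈ Finset.range (f.totalDegree + 1)
  swap
  · rw [MvPolynomial.homogeneousComponent_eq_zero _ _ (by simp at ht; omega)]
    exact zero_mem _
  rw [Ideal.mem_comap] at hf ⊢
  have h1 := h𝔠 (s * t) hf
  convert h1 using 1
  conv_rhs => rw [← MvPolynomial.sum_homogeneousComponent f, map_sum, DirectSum.decompose_sum,
    DFinsupp.finsetSum_apply, AddSubmonoidClass.coe_finsetSum]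
  rw [Finset.sum_eq_single_of_mem t ht, DirectSum.decompose_of_mem_same 𝒜 (hmem t)]
  intro u _ hut
  rw [DirectSum.decompose_of_mem_ne 𝒜 (hmem u)]
  exact fun h => hut (Nat.eq_of_mul_eq_mul_left hs h)

lemma growth_polynomial_bound [IsNoetherianRing R] [IsLocalRing R] (𝒜 : ℕ → Submodule R A)
    [GradedAlgebra 𝒜] (hgen : ∀ n, 𝒜 n = 𝒜 1 ^ n) (hfg : (𝒜 1).FG) {𝔠 : Ideal A}
    (h𝔠 : 𝔠.IsHomogeneous 𝒜) (D : ℕ) {σ : Type*} [Fintype σ] [DecidableEq σ] (s : ℕ) (hs : 0 < s)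
    (e : σ → A) (he : ∀ i, e i ∈ 𝒜 s)
    (hdim : ∀ P : Ideal A, P.IsPrime → P.IsHomogeneous 𝒜 → 𝔠 ≤ P → (∃ i, e i ∉ P) →
      Order.krullDim (ProjAbove 𝒜 P) ≤ D)
    (E' : Submodule R A) (N : ℕ)
    (hE' : IsLocalRing.maximalIdeal R ^ N • Submodule.span R (Set.range e) ≤ E') :
    ∃ w₀, ∀ w, w₀ ≤ w → GrowthBounded (D + 1)
      (growth (MvPolynomial.homogeneousSubmodule σ R) (baseLength R)
      (E'.comap (MvPolynomial.aeval e : MvPolynomial σ R →ₐ[R] A).toLinearMap ⊓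
        MvPolynomial.homogeneousSubmodule σ R 1)
      (𝔠.comap (MvPolynomial.aeval e : MvPolynomial σ R →ₐ[R] A)) w) := by
  set 𝒮 := MvPolynomial.homogeneousSubmodule σ R with h𝒮
  set φ := (MvPolynomial.aeval e : MvPolynomial σ R →ₐ[R] A) with hφ
  set E := E'.comap φ.toLinearMap ⊓ 𝒮 1 with hE
  have h𝒮gen (t : ℕ) : 𝒮 t = 𝒮 1 ^ t := (MvPolynomial.homogeneousSubmodule_one_pow R t).symm
  let 𝒢 : Set (PrimeSpectrum (MvPolynomial σ R)) := {p | p.asIdeal.IsHomogeneous 𝒮 ∧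
    ¬ (𝒮 1 : Set (MvPolynomial σ R)) ⊆ p.asIdeal}
  refine growth_bound 𝒮 (lam := baseLength R) (baseLength_isSubLength R) (E := E) inf_le_right 𝒢
    (fun p hp => hp.2) (𝔠.comap φ) ?_ ?_ (𝔠.comap φ)
    (isHomogeneous_comap_aeval 𝒜 hgen s hs e he h𝔠) le_rfl (D + 1) ?_
  · intro 𝔞 _ w t hwt
    refine ne_top_of_le_ne_top ?_ (baseLength_anti R (𝒮 t) le_sup_right)
    refine baseLength_ne_top_of_pow_smul_le (IsLocalRing.maximalIdeal R) (Ideal.map_id _)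
      (N * (t - w)) (MvPolynomial.homogeneousSubmodule_fg σ R t) ?_
    have h1 : IsLocalRing.maximalIdeal R ^ N • 𝒮 1 ≤ E := by
      refine le_inf ?_ Submodule.smul_le_right
      rw [← Submodule.map_le_iff_le_comap, Submodule.map_smul'', map_aeval_homogeneousSubmodule,
        pow_one]
      exact hE'
    have h2 : 𝒮 t = 𝒮 1 ^ (t - w) * 𝒮 w := by
      rw [h𝒮gen t, h𝒮gen w, ← pow_add, Nat.sub_add_cancel hwt]
    rw [h2, pow_mul]
    exact ideal_pow_smul_mul_le (ideal_pow_smul_pow_le h1 _)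
  · intro p hph _ hp
    refine ⟨0, fun w _ => ?_⟩
    have h1 : (𝒮 1 : Set (MvPolynomial σ R)) ⊆ p.asIdeal := by
      by_contra h
      exact hp ⟨hph, h⟩
    filter_upwards [Filter.eventually_ge_atTop 1] with t ht
    refine baseLength_eq_zero_of_le R (le_sup_of_le_left (le_inf ?_ le_rfl))
    obtain ⟨t', rfl⟩ : ∃ t', t = t' + 1 := ⟨t - 1, by omega⟩
    rw [h𝒮gen, pow_succ, Submodule.mul_le]
    intro a _ b hb
    exact Ideal.mul_mem_left _ _ (h1 hb)
  · intro c hc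
    have hX (p : PrimeSpectrum (MvPolynomial σ R)) (hp : p ∈ c) :
        ∃ i, (MvPolynomial.X i : MvPolynomial σ R) ∉ p.asIdeal := by
      by_contra! h
      refine (hc p hp).1.2 ?_
      change 𝒮 1 ≤ p.asIdeal.restrictScalars R
      rw [h𝒮, MvPolynomial.homogeneousSubmodule_one_eq_span_X, Submodule.span_le]
      rintro _ ⟨i, rfl⟩
      exact h i
    have hhead := hc c.head c.head_mem
    have hlast := hc c.last c.last_mem
    have := c.head.isPrime
    obtain ⟨𝔫, h𝔫, h𝔫le⟩ := Ideal.exists_minimalPrimes_le hhead.2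
    obtain ⟨P, hP, hPcomap⟩ := Ideal.exists_minimalPrimes_comap_eq (φ : MvPolynomial σ R →+* A) 𝔫 h𝔫
    have hPprime : P.IsPrime := hP.1.1
    have hPh : P.IsHomogeneous 𝒜 := by
      have h1 : (Ideal.homogeneousCore 𝒜 P).toIdeal = P := by
        refine le_antisymm (Ideal.toIdeal_homogeneousCore_le 𝒜 P) ?_
        refine hP.2 ⟨hPprime.homogeneousCore, ?_⟩ (Ideal.toIdeal_homogeneousCore_le 𝒜 P)
        rw [← h𝔠.toIdeal_homogeneousCore_eq_self]
        exact Ideal.homogeneousCore_mono 𝒜 hP.1.2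
      rw [← h1]
      exact HomogeneousIdeal.isHomogeneous _
    have hPle : P.comap φ ≤ c.head.asIdeal := hPcomap.le.trans h𝔫le
    obtain ⟨i, hi⟩ := hX c.head c.head_mem
    have hei : e i ∉ P := fun h => hi (hPle (by simpa [Ideal.mem_comap, hφ] using h))
    have hP1 : ¬ (𝒜 1 : Set A) ⊆ P := by
      intro h
      apply hei
      have h2 := he i
      obtain ⟨s', rfl⟩ : ∃ s', s = s' + 1 := ⟨s - 1, by omega⟩
      rw [hgen, pow_succ] at h2
      have h3 : 𝒜 1 ^ s' * 𝒜 1 ≤ P.restrictScalars R := by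
        rw [Submodule.mul_le]
        intro a _ b hb
        exact Ideal.mul_mem_left _ _ (h hb)
      exact h3 h2
    refine Nat.lt_succ_of_le (series_length_le 𝒜 hgen hfg P hPh hP1 D
      (hdim P hPprime hPh hP.1.2 ⟨i, hei⟩) s hs e he c hPle ?_ (hX c.last c.last_mem))
    intro f hf
    have h1 := hlast.1.1 0 hf
    rwa [decompose_eq_homogeneousComponent, MvPolynomial.homogeneousComponent_zero] at h1

end PolynomialGrowth

section ModuleGrowth

variable {R A M : Type*} [CommRing R] [CommRing A] [Algebra R A]
  [AddCommGroup M] [Module R M] [Module A M] [IsScalarTower R A M]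

lemma baseLength_sup_sup_le {P₁ P₂ Q₁ Q₂ : Submodule R M} :
    baseLength R (P₁ ⊔ P₂) (Q₁ ⊔ Q₂) ≤ baseLength R P₁ Q₁ + baseLength R P₂ Q₂ := by
  rw [baseLength_add R (le_sup_left : Q₁ ≤ Q₁ ⊔ Q₂), add_comm]
  refine add_le_add (baseLength_anti R _ le_sup_left) ?_
  calc baseLength R (P₁ ⊔ P₂ ⊔ Q₁) (Q₁ ⊔ Q₂)
      ≤ baseLength R (P₁ ⊔ P₂ ⊔ Q₁) (Q₂ ⊔ (P₁ ⊔ P₂ ⊔ Q₁)) :=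
        baseLength_mono R (sup_le (le_sup_of_le_right le_sup_right) le_sup_left)
    _ = baseLength R (P₁ ⊔ P₂ ⊔ Q₁) Q₂ := baseLength_sup_right R
    _ ≤ baseLength R P₂ Q₂ := baseLength_anti R _ (le_sup_of_le_left le_sup_right)

/-- A growth bound over the polynomial ring yields one for the finitely generated module. -/
lemma growthBounded_baseLength_smul {σ : Type*} (e : σ → A) (E' : Submodule R A) (d w : ℕ)
    (h : GrowthBounded d (growth (MvPolynomial.homogeneousSubmodule σ R) (baseLength R)
      (E'.comap (MvPolynomial.aeval e : MvPolynomial σ R →ₐ[R] A).toLinearMap ⊓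
        MvPolynomial.homogeneousSubmodule σ R 1)
      ((Module.annihilator A M).comap (MvPolynomial.aeval e : MvPolynomial σ R →ₐ[R] A)) w))
    (N : Submodule R M) (hN : N.FG) :
    GrowthBounded d (fun t => baseLength R
      ((E' ^ (t - w) * Submodule.span R (Set.range e) ^ w) • N)
      (Submodule.span R (Set.range e) ^ t • N)) := by
  set φ := (MvPolynomial.aeval e : MvPolynomial σ R →ₐ[R] A) with hφ
  set E := Submodule.span R (Set.range e)
  induction N, hN using Submodule.fg_induction with
  | singleton m =>
    refine h.mono (Filter.Eventually.of_forall fun t => ?_)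
    let f : MvPolynomial σ R →ₗ[R] M :=
      ((LinearMap.toSpanSingleton A M m).restrictScalars R).comp φ.toLinearMap
    have hf (z) : f z = φ z • m := rfl
    have hm : m ∈ Submodule.span R {m} := Submodule.mem_span_singleton_self m
    refine baseLength_le_of_surj R f ?_ ?_ ?_
    · intro z hz
      rw [Submodule.mem_comap, hf]
      refine Submodule.smul_mem_smul ?_ hm
      rw [← map_aeval_homogeneousSubmodule]
      exact ⟨z, hz, rfl⟩
    · refine sup_le ?_ ?_
      · rintro z ⟨hz, _⟩
        rw [Submodule.mem_comap, hf, Module.mem_annihilator.mp hz m]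
        exact zero_mem _
      · intro z hz
        rw [Submodule.mem_comap, hf]
        refine Submodule.smul_mem_smul ?_ hm
        have h1 := Submodule.mem_map_of_mem (f := φ.toLinearMap) hz
        rw [Submodule.map_mul, Submodule.map_pow, map_aeval_homogeneousSubmodule] at h1
        have h2 : (E'.comap φ.toLinearMap ⊓ MvPolynomial.homogeneousSubmodule σ R 1).map
            φ.toLinearMap ≤ E' := Submodule.map_le_iff_le_comap.mpr inf_le_left
        have h3 := mul_le_mul_left (pow_le_pow_left' h2 (t - w)) (E ^ w)
        exact h3 h1
    · refine le_sup_of_le_left (Submodule.smul_le.mpr fun a ha y hy => ?_)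
      obtain ⟨r, rfl⟩ := Submodule.mem_span_singleton.mp hy
      rw [← map_aeval_homogeneousSubmodule] at ha
      obtain ⟨z, hz, rfl⟩ := ha
      refine ⟨r • z, Submodule.smul_mem _ _ hz, ?_⟩
      rw [map_smul, hf, smul_comm]
      rfl
  | sup N₁ N₂ _ _ h₁ h₂ =>
    refine (h₁.add h₂).mono (Filter.Eventually.of_forall fun t => ?_)
    rw [Submodule.smul_sup, Submodule.smul_sup]
    exact baseLength_sup_sup_le

variable (𝒜 : ℕ → Submodule R A) [GradedAlgebra 𝒜]

lemma decompose_smul_of_mem (hgen : ∀ n, 𝒜 n = 𝒜 1 ^ n) (ℳ : ℕ → Submodule R M)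
    [DirectSum.Decomposition ℳ] (hMdeg : ∀ n, ℳ n = smulSM (𝒜 n) (ℳ 0)) (a : A) {k n : ℕ} {m : M}
    (hm : m ∈ ℳ k) : (DirectSum.decompose ℳ (a • m) (n + k) : M) =
      (DirectSum.decompose 𝒜 a n : A) • m := by
  induction a using DirectSum.Decomposition.inductionOn 𝒜 with
  | zero => simp
  | @homogeneous l a =>
    have h1 : (a : A) • m ∈ ℳ (l + k) := by
      rw [← piece_smul 𝒜 hgen ℳ hMdeg]
      exact Submodule.smul_mem_smul a.2 hm
    by_cases hl : l = n
    · subst hl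
      rw [DirectSum.decompose_of_mem_same ℳ h1, DirectSum.decompose_of_mem_same 𝒜 a.2]
    · rw [DirectSum.decompose_of_mem_ne ℳ h1 (by omega), DirectSum.decompose_of_mem_ne 𝒜 a.2 hl,
        zero_smul]
  | add a b ha hb =>
    rw [add_smul, DirectSum.decompose_add, DirectSum.add_apply, Submodule.coe_add, ha, hb,
      DirectSum.decompose_add, DirectSum.add_apply, Submodule.coe_add, add_smul]

lemma isHomogeneous_annihilator (hgen : ∀ n, 𝒜 n = 𝒜 1 ^ n) (ℳ : ℕ → Submodule R M)
    (hMint : DirectSum.IsInternal ℳ) (hMdeg : ∀ n, ℳ n = smulSM (𝒜 n) (ℳ 0)) :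
    (Module.annihilator A M).IsHomogeneous 𝒜 := by
  let := hMint.chooseDecomposition
  intro n a ha
  rw [Module.mem_annihilator] at ha ⊢
  intro m
  induction m using DirectSum.Decomposition.inductionOn ℳ with
  | zero => simp
  | @homogeneous k m =>
    rw [← decompose_smul_of_mem 𝒜 hgen ℳ hMdeg a m.2, ha]
    simp
  | add m m' h h' => rw [smul_add, h, h', add_zero]

lemma piece_zero_fg (hgen : ∀ n, 𝒜 n = 𝒜 1 ^ n) (ℳ : ℕ → Submodule R M)
    (hMint : DirectSum.IsInternal ℳ) (hMdeg : ∀ n, ℳ n = smulSM (𝒜 n) (ℳ 0))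
    [Module.Finite A M] : (ℳ 0).FG := by
  classical
  let := hMint.chooseDecomposition
  obtain ⟨W, hW⟩ := Module.Finite.fg_top (R := A) (M := M)
  have hsmul (a : A) (m : M) : (DirectSum.decompose ℳ (a • m) 0 : M) =
      (DirectSum.decompose 𝒜 a 0 : A) • (DirectSum.decompose ℳ m 0 : M) := by
    induction m using DirectSum.Decomposition.inductionOn ℳ with
    | zero => simp
    | @homogeneous k m =>
      by_cases hk : k = 0
      · subst hk
        rw [DirectSum.decompose_of_mem_same ℳ m.2]
        exact decompose_smul_of_mem 𝒜 hgen ℳ hMdeg a (n := 0) m.2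
      · rw [DirectSum.decompose_of_mem_ne ℳ m.2 hk, smul_zero]
        induction a using DirectSum.Decomposition.inductionOn 𝒜 with
        | zero => simp
        | @homogeneous l a =>
          have h1 : (a : A) • (m : M) ∈ ℳ (l + k) := by
            rw [← piece_smul 𝒜 hgen ℳ hMdeg]
            exact Submodule.smul_mem_smul a.2 m.2
          rw [DirectSum.decompose_of_mem_ne ℳ h1 (by omega)]
        | add a b ha hb =>
          rw [add_smul, DirectSum.decompose_add, DirectSum.add_apply, Submodule.coe_add, ha, hb,
            add_zero]
    | add m m' h h' =>
      rw [smul_add, DirectSum.decompose_add, DirectSum.add_apply, Submodule.coe_add, h, h',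
        DirectSum.decompose_add, DirectSum.add_apply, Submodule.coe_add, smul_add]
  refine ⟨W.image fun m => (DirectSum.decompose ℳ m 0 : M), le_antisymm ?_ ?_⟩
  · rw [Submodule.span_le]
    intro z hz
    obtain ⟨m, _, rfl⟩ := Finset.mem_image.mp hz
    exact SetLike.coe_mem _
  · intro z hz
    have hz' : z ∈ Submodule.span A (W : Set M) := hW ▸ Submodule.mem_top
    rw [← DirectSum.decompose_of_mem_same ℳ hz]
    clear hz
    induction hz' using Submodule.span_induction with
    | mem m hm => exact Submodule.subset_span (Finset.mem_image_of_mem _ hm)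
    | zero => simp
    | add x y _ _ hx hy =>
      rw [DirectSum.decompose_add, DirectSum.add_apply, Submodule.coe_add]
      exact add_mem hx hy
    | smul a y _ hy =>
      rw [hsmul]
      have h0 : (DirectSum.decompose 𝒜 a 0 : A) ∈ (1 : Submodule R A) :=
        ((hgen 0).trans (pow_zero _)).le (SetLike.coe_mem _)
      obtain ⟨r, hr⟩ := Submodule.mem_one.mp h0
      rw [← hr, algebraMap_smul]
      exact Submodule.smul_mem _ _ hy

lemma annihilator_quotient_sat_le [IsNoetherianRing A] [Module.Finite A M] {𝓘 P : Ideal A}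
    [P.IsPrime] (hP : Module.annihilator A M ≤ P) (h𝓘 : ¬ 𝓘 ≤ P) :
    Module.annihilator A (M ⧸ sat 𝓘 (⊥ : Submodule A M)) ≤ P := by
  obtain ⟨n, hn⟩ := exists_pow_smul_inf_sat_eq_bot (M := M) 𝓘
  obtain ⟨b, hb, hbP⟩ := SetLike.not_le_iff_exists.mp h𝓘
  intro a ha
  have h1 : b ^ n * a ∈ Module.annihilator A M := by
    rw [Module.mem_annihilator]
    intro m
    have h2 : a • m ∈ sat 𝓘 (⊥ : Submodule A M) := by
      rw [← Submodule.Quotient.mk_eq_zero, Submodule.Quotient.mk_smul]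
      exact Module.mem_annihilator.mp ha _
    have h3 : b ^ n • a • m ∈ 𝓘 ^ n • (⊤ : Submodule A M) ⊓ sat 𝓘 (⊥ : Submodule A M) :=
      ⟨Submodule.smul_mem_smul (Ideal.pow_mem_pow hb n) Submodule.mem_top,
        Submodule.smul_mem _ _ h2⟩
    rw [hn, Submodule.mem_bot] at h3
    rw [mul_smul, h3]
  exact ((Ideal.IsPrime.mem_or_mem ‹_› (hP h1)).resolve_left
    fun h => hbP (Ideal.IsPrime.mem_of_pow_mem ‹_› n h))

lemma exists_pow_maximalIdeal_smul_le [IsLocalRing R] {P Q : Submodule R M}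
    (h : colength R P Q ≠ ⊤) : ∃ n, IsLocalRing.maximalIdeal R ^ n • Q ≤ P := by
  rw [colength, ← Module.length_eq_height] at h
  obtain ⟨n, hn⟩ := exists_pow_smul_eq_zero_of_length_ne_top h
  refine ⟨n, Submodule.smul_le.mpr fun a ha y hy => ?_⟩
  have h1 := hn a ha (Submodule.Quotient.mk ⟨y, hy⟩)
  rw [← Submodule.Quotient.mk_smul, Submodule.Quotient.mk_eq_zero] at h1
  exact h1

/-- Along the ray of direction `(a, b, c)`, the mixed length function grows at most like `t ^ D`. -/
lemma mixedLen_ray_bound [IsNoetherianRing R] [IsLocalRing R]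
    (hgen : ∀ n, 𝒜 n = 𝒜 1 ^ n) (hGfg : (𝒜 1).FG)
    (ℳ : ℕ → Submodule R M) (hMint : DirectSum.IsInternal ℳ)
    (hMdeg : ∀ n, ℳ n = smulSM (𝒜 n) (ℳ 0)) [Module.Finite A M]
    {q : ℕ} (I : Fin q → Submodule R A) (hI1 : ∀ i, I i ≤ 𝒜 1) (hIfg : ∀ i, (I i).FG)
    (J : Submodule R A) (hJco : colength R J (𝒜 1) ≠ ⊤) (D : ℕ)
    (hD : dimProjSupp 𝒜 (sat (idealGen I) (⊥ : Submodule A M)) = ((D : ℕ∞) : WithBot ℕ∞))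
    (a b : ℕ) (ha : 0 < a) (c : Fin q → ℕ) (hc : ∀ i, 0 < c i) :
    ∃ w, GrowthBounded (D + 1) fun t =>
        mixedLen J I ℳ (a * (t - w)) (b * t + a * w) fun i => t * c i := by
  have hNoeth := isNoetherianRing_of_graded 𝒜 hgen hGfg
  set E := Ipow I c * 𝒜 (a + b) with hE
  set E' := J ^ a * (Ipow I c * 𝒜 b) with hE'
  set s := (∑ i, c i) + (a + b) with hs
  have hEs : E ≤ 𝒜 s := by
    rw [hs, ← piece_mul 𝒜 hgen]
    exact mul_le_mul_left (Ipow_le_piece 𝒜 hgen hI1 c) _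
  have hEfg : E.FG := by
    refine Submodule.FG.mul ?_ ?_
    · rw [Ipow]
      exact Finset.prod_induction _ Submodule.FG (fun _ _ h h' => h.mul h')
        (by rw [Submodule.one_eq_span]; exact Submodule.fg_span_singleton 1)
        fun i _ => (hIfg i).pow _
    · rw [hgen]
      exact hGfg.pow _
  obtain ⟨n, e, he⟩ := Submodule.fg_iff_exists_fin_generating_family.mp hEfg
  obtain ⟨N₀, hN₀⟩ := exists_pow_maximalIdeal_smul_le hJco
  have hbound := growth_polynomial_bound 𝒜 hgen hGfg
    (isHomogeneous_annihilator 𝒜 hgen ℳ hMint hMdeg) D s (by omega) e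
    (fun i => hEs (he ▸ Submodule.subset_span ⟨i, rfl⟩)) ?_ E' (N₀ * a) ?_
  · obtain ⟨w, hw⟩ := hbound
    refine ⟨w, (growthBounded_baseLength_smul e E' (D + 1) w (hw w le_rfl) (ℳ 0)
      (piece_zero_fg 𝒜 hgen ℳ hMint hMdeg)).mono ?_⟩
    filter_upwards [Filter.eventually_ge_atTop w] with t ht
    obtain ⟨u, rfl⟩ := Nat.exists_eq_add_of_le ht
    have hIp (v : ℕ) : Ipow I (fun i => v * c i) = Ipow I c ^ v := by
      rw [Ipow, Ipow, ← Finset.prod_pow]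
      exact Finset.prod_congr rfl fun i _ => by rw [mul_comm, pow_mul]
    have hpiece (v : ℕ) : ℳ v = 𝒜 1 ^ v • ℳ 0 := by rw [hMdeg, smulSM_eq_smul, hgen]
    refine le_of_eq ?_
    rw [mixedLen_eq, hIp, he, hpiece (_ + _), hpiece (_ + _), ← mul_smul_submodule,
      ← mul_smul_submodule, hE, hE', hgen (a + b), hgen b, Nat.add_sub_cancel_left]
    congr 2 <;> ring
  · intro P hP hPh hann ⟨i, hi⟩
    have h𝓘 : ¬ idealGen I ≤ P := by
      intro h
      have h1 : e i ∈ E := he ▸ Submodule.subset_span ⟨i, rfl⟩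
      have h2 : E ≤ P.restrictScalars R := by
        have h3 : E = (∏ i, I i) * (Ipow I (fun i => c i - 1) * 𝒜 (a + b)) := by
          rw [← mul_assoc, hE, Ipow, Ipow, ← Finset.prod_mul_distrib]
          congr 1
          exact Finset.prod_congr rfl fun i _ => by rw [← pow_succ', Nat.sub_add_cancel (hc i)]
        rw [h3, Submodule.mul_le]
        intro x hx y _
        exact Ideal.mul_mem_right _ _ (h (Ideal.subset_span hx))
      exact hi (h2 h1)
    have hle := annihilator_quotient_sat_le hann h𝓘
    change _ ≤ ((D : ℕ∞) : WithBot ℕ∞)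
    rw [← hD, dimProjSupp]
    exact Order.krullDim_le_of_strictMono
      (fun Q : ProjAbove 𝒜 P => ⟨Q.1, Q.2.1, Q.2.2.1, hle.trans Q.2.2.2⟩) fun _ _ h => h
  · rw [he, hE, hE', show Ipow I c * 𝒜 (a + b) = 𝒜 1 ^ a * (Ipow I c * 𝒜 b) by
      rw [← piece_mul 𝒜 hgen, hgen a]; ring, pow_mul]
    exact ideal_pow_smul_mul_le (ideal_pow_smul_pow_le hN₀ a)

end ModuleGrowth

section DegreeBound

lemma eval_smul_of_isHomogeneous {σ S : Type*} [CommRing S] {P : MvPolynomial σ S} {k : ℕ}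
    (h : P.IsHomogeneous k) (t : S) (v : σ → S) :
    MvPolynomial.eval (fun i => t * v i) P = t ^ k * MvPolynomial.eval v P := by
  rw [MvPolynomial.eval_eq, MvPolynomial.eval_eq, Finset.mul_sum]
  refine Finset.sum_congr rfl fun d hd => ?_
  have hdeg : ∑ i ∈ d.support, d i = k := by
    have := h (MvPolynomial.mem_support_iff.mp hd)
    rwa [Pi.one_def, ← Finsupp.degree_eq_weight_one] at this
  simp_rw [mul_pow]
  rw [Finset.prod_mul_distrib, Finset.prod_pow_eq_pow_sum, hdeg]
  ring

/-- The leading form of a polynomial which grows at most like `t ^ D` along `t ↦ t v + u` vanishes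
at `v`, if its degree exceeds `D`. -/
lemma eval_homogeneousComponent_eq_zero {n D : ℕ} (P : MvPolynomial (Fin n) ℚ)
    (hD : D < P.totalDegree) (v u : Fin n → ℚ) (K : ℚ)
    (h : ∀ᶠ t : ℕ in Filter.atTop,
      |MvPolynomial.eval (fun i => (t : ℚ) * v i + u i) P| ≤ K * (t : ℚ) ^ D) :
    MvPolynomial.eval v (MvPolynomial.homogeneousComponent P.totalDegree P) = 0 := by
  set d := P.totalDegree with hd
  let F : ℚ → ℚ := fun ε => ∑ k ∈ Finset.range (d + 1), ε ^ (d - k) *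
    MvPolynomial.eval (fun i => v i + ε * u i) (MvPolynomial.homogeneousComponent k P)
  have hF0 : F 0 = MvPolynomial.eval v (MvPolynomial.homogeneousComponent d P) := by
    simp only [F]
    rw [Finset.sum_eq_single_of_mem d (by simp)]
    · simp
    · intro k hk hkd
      rw [Finset.mem_range] at hk
      rw [zero_pow (by omega), zero_mul]
  have hFcont : Continuous F := by
    refine continuous_finsetSum _ fun k _ => (continuous_pow _).mul ?_
    exact (MvPolynomial.continuous_eval _).comp (by fun_prop)
  have hFt (t : ℚ) (ht : t ≠ 0) :
      MvPolynomial.eval (fun i => t * v i + u i) P = t ^ d * F (t⁻¹) := by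
    conv_lhs => rw [← MvPolynomial.sum_homogeneousComponent P, map_sum]
    rw [Finset.mul_sum]
    refine Finset.sum_congr rfl fun k hk => ?_
    rw [Finset.mem_range] at hk
    have h1 : (fun i => t * v i + u i) = fun i => t * (v i + t⁻¹ * u i) := by
      funext i
      field_simp
    rw [h1, eval_smul_of_isHomogeneous (MvPolynomial.homogeneousComponent_isHomogeneous k P),
      ← mul_assoc]
    congr 1
    rw [inv_pow, ← div_eq_mul_inv, eq_div_iff (pow_ne_zero _ ht), ← pow_add]
    congr 1
    omega
  have hinv : Filter.Tendsto (fun t : ℕ => ((t : ℚ))⁻¹) Filter.atTop (nhds 0) :=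
    tendsto_inv_atTop_zero.comp tendsto_natCast_atTop_atTop
  have hlim : Filter.Tendsto (fun t : ℕ => F ((t : ℚ))⁻¹) Filter.atTop (nhds (F 0)) :=
    (hFcont.tendsto 0).comp hinv
  have hzero : Filter.Tendsto (fun t : ℕ => F ((t : ℚ))⁻¹) Filter.atTop (nhds 0) := by
    rw [tendsto_zero_iff_abs_tendsto_zero]
    have hK : Filter.Tendsto (fun t : ℕ => |K| * ((t : ℚ))⁻¹) Filter.atTop (nhds 0) := by
      simpa using hinv.const_mul |K|
    refine tendsto_of_tendsto_of_tendsto_of_le_of_le' tendsto_const_nhds hK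
      (Filter.Eventually.of_forall fun t => abs_nonneg _) ?_
    filter_upwards [h, Filter.eventually_ge_atTop 1] with t ht ht1
    have ht1' : (1 : ℚ) ≤ t := by exact_mod_cast ht1
    have ht0 : (0 : ℚ) < t := by linarith
    rw [hFt t ht0.ne', abs_mul, abs_of_pos (pow_pos ht0 d)] at ht
    have h2 : (t : ℚ) ^ (D + 1) * |F (t : ℚ)⁻¹| ≤ (t : ℚ) ^ d * |F (t : ℚ)⁻¹| :=
      mul_le_mul_of_nonneg_right (pow_le_pow_right₀ ht1' hD) (abs_nonneg _)
    have h3 : K * (t : ℚ) ^ D ≤ |K| * (t : ℚ) ^ D :=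
      mul_le_mul_of_nonneg_right (le_abs_self K) (by positivity)
    change |F (t : ℚ)⁻¹| ≤ |K| * (t : ℚ)⁻¹
    rw [← div_eq_mul_inv, le_div_iff₀ ht0]
    have h4 : (t : ℚ) ^ D * (|F (t : ℚ)⁻¹| * t) ≤ (t : ℚ) ^ D * |K| := by
      calc (t : ℚ) ^ D * (|F (t : ℚ)⁻¹| * t) = (t : ℚ) ^ (D + 1) * |F (t : ℚ)⁻¹| := by ring
        _ ≤ _ := (h2.trans (ht.trans h3)).trans_eq (mul_comm _ _)
    exact le_of_mul_le_mul_left h4 (by positivity)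
  rw [← hF0]
  exact tendsto_nhds_unique hlim hzero

variable {R A M : Type*} [CommRing R] [CommRing A] [Algebra R A]
  [AddCommGroup M] [Module R M] [Module A M]

/-- A Hilbert polynomial has degree at most `D` if the Hilbert function grows at most like `t ^ D`
along rays in positive directions. -/
lemma totalDegree_le_of_ray_bound {q : ℕ} (J : Submodule R A) (I : Fin q → Submodule R A)
    (ℳ : ℕ → Submodule R M) (P : MvPolynomial (Fin (q + 2)) ℚ) (hP : IsMixedPoly J I ℳ P) (D : ℕ)
    (hbound : ∀ (a b : ℕ) (c : Fin q → ℕ), 0 < a → 0 < b → (∀ i, 0 < c i) →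
      ∃ w, GrowthBounded (D + 1) fun t =>
        mixedLen J I ℳ (a * (t - w)) (b * t + a * w) fun i => t * c i) :
    P.totalDegree ≤ D := by
  by_contra! hlt
  have hne : MvPolynomial.homogeneousComponent P.totalDegree P ≠ 0 := by
    have hP0 : P ≠ 0 := by
      rintro rfl
      simp at hlt
    obtain ⟨d, hd, hdeg⟩ := Finset.exists_mem_eq_sup P.support
      (MvPolynomial.support_nonempty.mpr hP0) fun s => s.sum fun _ e => e
    intro h0
    have h1 := MvPolynomial.coeff_homogeneousComponent P.totalDegree P d
    rw [h0, MvPolynomial.coeff_zero,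
      if_pos (show Finsupp.degree d = P.totalDegree from hdeg.symm)] at h1
    exact MvPolynomial.mem_support_iff.mp hd h1.symm
  refine hne (mv_eq_of_eval_vals _ 0 1 fun a b c ha hb hc => ?_)
  rw [map_zero]
  obtain ⟨w, K, hK⟩ := hbound a b c ha hb hc
  obtain ⟨N, hN⟩ := hP
  refine eval_homogeneousComponent_eq_zero P hlt (vals a b c)
    (Fin.cons (-(a * w : ℚ)) (Fin.cons (a * w : ℚ) fun _ => 0)) K ?_
  filter_upwards [hK, Filter.eventually_ge_atTop (N + w)] with t ht htN
  obtain ⟨L, hL, hev⟩ := hN (a * (t - w)) (b * t + a * w) (fun i => t * c i)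
    (le_trans (by omega) (Nat.le_mul_of_pos_left _ ha))
    (le_trans (show N ≤ t by omega) ((Nat.le_mul_of_pos_left _ hb).trans (Nat.le_add_right _ _)))
    (fun i => le_trans (show N ≤ t by omega) (Nat.le_mul_of_pos_right _ (hc i)))
  have hpt : (fun i => (t : ℚ) * vals a b c i +
      (Fin.cons (-(a * w : ℚ)) (Fin.cons (a * w : ℚ) fun _ => 0) : Fin (q + 2) → ℚ) i) =
      vals (a * (t - w)) (b * t + a * w) (fun i => t * c i) := by
    funext l
    refine Fin.cases ?_ (fun l => Fin.cases ?_ (fun l => ?_) l) l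
    · simp only [vals, Fin.cons_zero]
      push_cast [Nat.cast_sub (show w ≤ t by omega)]
      ring
    · simp only [vals, Fin.cons_succ, Fin.cons_zero]
      push_cast
      ring
    · simp only [vals, Fin.cons_succ]
      push_cast
      ring
  rw [hpt, hev, abs_of_nonneg (by positivity)]
  rw [hL] at ht
  exact_mod_cast ht

end DegreeBound

/-! ## Setup (1):
`(R, 𝔪)` a Noetherian local ring; `A` a graded `R`-algebra with grading `𝒜`,
generated as an `R`-algebra by finitely many elements of degree one
(`𝒜 n = (𝒜 1)ⁿ` and `𝒜 1` finitely generated); `M` a finitely generated graded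
`A`-module with grading `ℳ`, generated in degree zero (`ℳ n = 𝒜 n · ℳ 0`);
`I₁, …, I_q` finitely generated `R`-submodules of `𝒜 1`; `𝓘 = idealGen I` the
ideal of `A` generated by `I₁⋯I_q`. -/

variable {R A M : Type*} [CommRing R] [IsNoetherianRing R] [IsLocalRing R]
  [CommRing A] [Algebra R A]
  [AddCommGroup M] [Module R M] [Module A M] [IsScalarTower R A M]

/-- **(Proposition 4.5 (i).)** Assume `𝓘` is not contained in `√(Ann M)`, let
`k₀ + j + k₁ + ⋯ + k_q = D = dim Supp M*` and let `i ≥ 1` be an index with `k_i > 0`. If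
`x ∈ I_i` is an (FC)-element with respect to `(J, I₁, …, I_q; M)`, then
`e^j(J^{[k₀]}, …, I_i^{[k_i]}, …; M) = e^j(J^{[k₀]}, …, I_i^{[k_i - 1]}, …; M/xM)`. -/
theorem mixed_multiplicity_FC_element
    (𝒜 : ℕ → Submodule R A) [GradedAlgebra 𝒜]
    (hgen : ∀ n, 𝒜 n = 𝒜 1 ^ n) (hGfg : (𝒜 1).FG)
    (ℳ : ℕ → Submodule R M) (hMint : DirectSum.IsInternal ℳ)
    (hMdeg : ∀ n, ℳ n = smulSM (𝒜 n) (ℳ 0)) [Module.Finite A M]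
    {q : ℕ} (I : Fin q → Submodule R A) (hI1 : ∀ i, I i ≤ 𝒜 1) (hIfg : ∀ i, (I i).FG)
    (J : Submodule R A) (hJ1 : J ≤ 𝒜 1) (hJfg : J.FG) (hJco : colength R J (𝒜 1) ≠ ⊤)
    (h𝓘 : ¬ idealGen I ≤ (Module.annihilator A M).radical)
    (D : ℕ)
    (hD : dimProjSupp 𝒜 (sat (idealGen I) (⊥ : Submodule A M)) = ((D : ℕ∞) : WithBot ℕ∞))
    (k0 j : ℕ) (k : Fin q → ℕ) (hsum : k0 + j + ∑ i, k i = D)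
    (i : Fin q) (hki : 0 < k i) (x : A)
    (hx : IsFCElemAt R 𝒜 ℳ (Fin.cons J I) (idealGen I) i.succ x ⊥ ⊥) :
    ∀ (P P' : MvPolynomial (Fin (q + 2)) ℚ), IsMixedPoly J I ℳ P →
      IsMixedPoly J I (quotPieces ℳ (spanM {x})) P' →
      mixedCoeff P k0 j k = mixedCoeff P' k0 j (Function.update k i (k i - 1)) := by
  intro P P' hP hP'
  have hdeg : P.totalDegree ≤ k0 + j + ∑ i, k i := by
    rw [hsum]
    exact totalDegree_le_of_ray_bound J I ℳ P hP D fun a b c ha _ hc =>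
      mixedLen_ray_bound 𝒜 hgen hGfg ℳ hMint hMdeg I hI1 hIfg J hJco D hD a b ha c hc
  refine mixedCoeff_eq_of_sub_shift P P' i ?_ k0 j k hki hdeg
  obtain ⟨N, hN⟩ := mixedLen_eq_add 𝒜 hgen hGfg ℳ hMint hMdeg I hI1 J hJ1 i x hx.1
  obtain ⟨N₁, hN₁⟩ := hP
  obtain ⟨N₂, hN₂⟩ := hP'
  refine mv_eq_of_eval_vals _ _ (N + N₁ + N₂ + 1) fun n p r hn hp hr => ?_
  have hri := hr i
  obtain ⟨L, hL, hPL⟩ := hN₁ n p r (by omega) (by omega) fun l => by have := hr l; omega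
  obtain ⟨L', hL', hPL'⟩ := hN₂ n p r (by omega) (by omega) fun l => by have := hr l; omega
  obtain ⟨L'', hL'', hPL''⟩ := hN₁ n p (Function.update r i (r i - 1)) (by omega) (by omega)
    fun l => by
      have := hr l
      by_cases hl : l = i
      · subst hl; rw [Function.update_self]; omega
      · rw [Function.update_of_ne hl]; omega
  have hlen := hN n p r fun l => by have := hr l; omega
  rw [hL, hL', hL''] at hlen
  rw [map_add, eval_shift, ← vals_update n p r i (by omega), hPL, hPL', hPL'']
  exact_mod_cast hlen

end MixedMult
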